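/- arXiv:math/0701441 — 2 statements merged into one kernel-verified Lean document; each statement's English description precedes it below -/
import Mathlib

section
/- The group IA(F₃) contains a subgroup isomorphic to the poison group H(F₂), and consequently IA(F₃) is not linear. -/
/-!
STATEMENT 10: The group `IA(F₃)` (the kernel of `Aut(F₃) → Aut(F₃ᵃᵇ)`) contains a
subgroup isomorphic to the poison group `H(F₂)`, and consequently `IA(F₃)` is not
linear.
-/
variable (G : Type*) [Group G]

/-- The diagonal subgroup `{(g,g)} ≤ G × G`. -/
def diagSubgroup : Subgroup (G × G) where
  carrier := {p | p.1 = p.2}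
  one_mem' := rfl
  mul_mem' := by
    intro a b (ha : a.1 = a.2) (hb : b.1 = b.2)
    show a.1 * b.1 = a.2 * b.2
    rw [ha, hb]
  inv_mem' := by
    intro a (ha : a.1 = a.2)
    show a.1⁻¹ = a.2⁻¹
    rw [ha]

/-- The subgroup `G × {1} ≤ G × G`. -/
def leftSubgroup : Subgroup (G × G) where
  carrier := {p | p.2 = 1}
  one_mem' := rfl
  mul_mem' := by
    intro a b (ha : a.2 = 1) (hb : b.2 = 1)
    show a.2 * b.2 = 1
    rw [ha, hb, mul_one]
  inv_mem' := by
    intro a (ha : a.2 = 1)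
    show a.2⁻¹ = 1
    rw [ha, inv_one]

/-- The isomorphism `(g,g) ↦ (g,1)` from the diagonal onto `G × {1}`. -/
def diagToLeft : diagSubgroup G ≃* leftSubgroup G where
  toFun x := ⟨(x.1.1, 1), rfl⟩
  invFun x := ⟨(x.1.1, x.1.1), rfl⟩
  left_inv := by
    rintro ⟨⟨a, b⟩, (h : a = b)⟩
    subst h
    rfl
  right_inv := by
    rintro ⟨⟨a, b⟩, (h : b = 1)⟩
    subst h
    rfl
  map_mul' x y := by
    apply Subtype.ext
    show ((x*y).1.1, (1:G)) = (x.1.1 * y.1.1, 1*1)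
    rw [mul_one]
    rfl

/-- The Formanek–Procesi group `H(G)`: the HNN extension of `G × G` with stable
letter `t` and the relations `t (g,g) t⁻¹ = (g,1)`. -/
def FPGroup : Type _ := HNNExtension (G × G) (diagSubgroup G) (leftSubgroup G) (diagToLeft G)

instance : Group (FPGroup G) := by delta FPGroup; infer_instance

/-- The poison group `H(F₂)`. -/
abbrev PoisonGroup : Type := FPGroup (FreeGroup (Fin 2))

/-- `IA(Fₙ)`: the subgroup of `Aut(Fₙ)` of automorphisms acting trivially on the
abelianization, i.e. the kernel of the natural map `Aut(Fₙ) → Aut(Fₙᵃᵇ)`. -/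
def IA (n : ℕ) : Subgroup (MulAut (FreeGroup (Fin n))) where
  carrier := {φ | ∀ x, Abelianization.of (φ x) = Abelianization.of x}
  one_mem' := fun _ => rfl
  mul_mem' := by
    intro a b ha hb x
    have h1 := ha (b x)
    have h2 := hb x
    simpa [MulAut.mul_apply, h2] using h1
  inv_mem' := by
    intro a ha x
    have := ha (a⁻¹ x)
    simpa using this.symm

/-- `L` has a faithful finite-dimensional representation over the field `K`. -/
def HasFaithfulRep (L : Type*) [Group L] (K : Type) [Field K] : Prop :=
  ∃ (n : ℕ) (f : L →* GL (Fin n) K), Function.Injective f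

/-- A group `L` is linear if it embeds in `GL(n, K)` for some field `K` and some `n`. -/
def IsLinear (L : Type*) [Group L] : Prop :=
  ∃ (K : Type) (inst : Field K), @HasFaithfulRep L _ K inst

open scoped commutatorElement

theorem Matrix.charpoly_blockDiagonal' {R ι : Type*} [CommRing R] {κ : ι → Type*} [Fintype ι]
    [DecidableEq ι] [∀ i, Fintype (κ i)] [∀ i, DecidableEq (κ i)]
    (M : ∀ i, Matrix (κ i) (κ i) R) :
    (Matrix.blockDiagonal' M).charpoly = ∏ i, (M i).charpoly := by
  let _ : LinearOrder ι := LinearOrder.lift' (Fintype.equivFin ι) (Equiv.injective _)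
  have h : (Matrix.blockDiagonal' M).BlockTriangular Sigma.fst := fun i j hij =>
    Matrix.blockDiagonal'_apply_ne _ _ _ hij.ne'
  rw [Matrix.charpoly, h.charmatrix.det_fintype]
  refine Finset.prod_congr rfl fun k _ => ?_
  rw [← Matrix.charmatrix_toSquareBlock, ← Matrix.charpoly,
    ← Matrix.charpoly_reindex (Equiv.sigmaSubtype k)]
  congr 1
  ext a b
  simp [Matrix.toSquareBlock_def, Matrix.blockDiagonal'_apply_eq, Equiv.sigmaSubtype]

theorem LinearMap.charpoly_eq_prod_charpoly_restrict {K V ι : Type*} [Field K] [AddCommGroup V]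
    [Module K V] [FiniteDimensional K V] [Fintype ι] [DecidableEq ι] {N : ι → Submodule K V}
    (h : DirectSum.IsInternal N) {f : V →ₗ[K] V} (hf : ∀ i, Set.MapsTo f (N i) (N i)) :
    f.charpoly = ∏ i, (f.restrict (hf i)).charpoly := by
  let b : ∀ i, Module.Basis (Fin (Module.finrank K (N i))) K (N i) := fun i =>
    Module.finBasis K (N i)
  rw [← LinearMap.charpoly_toMatrix f (h.collectedBasis b),
    LinearMap.toMatrix_directSum_collectedBasis_eq_blockDiagonal' h h b b hf,
    Matrix.charpoly_blockDiagonal']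
  simp_rw [LinearMap.charpoly_toMatrix]

theorem Module.End.maxGenEigenspace_le_add_of_isNilpotent {K V : Type*} [Field K]
    [AddCommGroup V] [Module K V] {X N : Module.End K V} (h : Commute X N) (hN : IsNilpotent N)
    (μ : K) : X.maxGenEigenspace μ ≤ (X + N).maxGenEigenspace μ := by
  intro x hx
  rw [Module.End.mem_maxGenEigenspace] at hx ⊢
  obtain ⟨k, hk⟩ := hx
  obtain ⟨m, hm⟩ := hN
  have hc : Commute (X - μ • 1) N := h.sub_left ((Commute.one_left N).smul_left μ)
  refine ⟨k + m, ?_⟩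
  rw [add_sub_right_comm, hc.add_pow, LinearMap.sum_apply]
  refine Finset.sum_eq_zero fun i hi => ?_
  rw [← Nat.cast_comm, (hc.pow_pow _ _).eq]
  rw [Module.End.mul_apply, Module.End.mul_apply]
  rcases le_or_gt k i with hki | hki
  · have : ((X - μ • 1) ^ i) x = 0 := by
      rw [← Nat.sub_add_cancel hki, pow_add, Module.End.mul_apply, hk, map_zero]
    rw [this, map_zero, map_zero]
  · rw [pow_eq_zero_of_le (by grind) hm, LinearMap.zero_apply, map_zero]

theorem Module.End.maxGenEigenspace_add_of_isNilpotent {K V : Type*} [Field K]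
    [AddCommGroup V] [Module K V] {X N : Module.End K V} (h : Commute X N) (hN : IsNilpotent N)
    (μ : K) : (X + N).maxGenEigenspace μ = X.maxGenEigenspace μ := by
  refine le_antisymm ?_ (maxGenEigenspace_le_add_of_isNilpotent h hN μ)
  simpa using maxGenEigenspace_le_add_of_isNilpotent (X := X + N) (N := -N)
    (h.add_left (Commute.refl N)).neg_right hN.neg μ

theorem Module.End.maxGenEigenspace_smul {K V : Type*} [Field K]
    [AddCommGroup V] [Module K V] (X : Module.End K V) {a : K} (ha : a ≠ 0)
    (μ : K) : (a • X).maxGenEigenspace (a * μ) = X.maxGenEigenspace μ := by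
  ext x
  simp only [Module.End.mem_maxGenEigenspace]
  refine exists_congr fun k => ?_
  rw [mul_smul, ← smul_sub, smul_pow, LinearMap.smul_apply,
    smul_eq_zero_iff_right (pow_ne_zero _ ha)]

theorem LinearMap.roots_charpoly_mul_of_isNilpotent_sub {K V : Type*} [Field K]
    [AddCommGroup V] [Module K V] [FiniteDimensional K V] {A B : Module.End K V}
    (h : Commute A B) {a : K} (ha : a ≠ 0) (hA : IsNilpotent (A - algebraMap K _ a)) :
    (A * B).charpoly.roots = B.charpoly.roots.map (a * ·) := by
  classical
  have hc : Commute (A - algebraMap K _ a) B :=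
    h.sub_left (Algebra.commutes a B)
  have hN : IsNilpotent ((A - algebraMap K _ a) * B) := hc.isNilpotent_mul_right hA
  have hAB : A * B = a • B + (A - algebraMap K _ a) * B := by
    rw [sub_mul, Algebra.smul_def]
    abel
  ext γ
  obtain ⟨β, rfl⟩ : ∃ β, γ = a * β := ⟨a⁻¹ * γ, by field_simp⟩
  rw [Multiset.count_map_eq_count' _ _ (mul_right_injective₀ ha), Polynomial.count_roots,
    Polynomial.count_roots, ← LinearMap.finrank_maxGenEigenspace_eq,
    ← LinearMap.finrank_maxGenEigenspace_eq, hAB,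
    Module.End.maxGenEigenspace_add_of_isNilpotent _ hN, Module.End.maxGenEigenspace_smul _ ha]
  exact (hc.symm.mul_right (Commute.refl B)).smul_left a

/-- The sum of the values of `f` at the roots of a polynomial, with multiplicities. -/
noncomputable def Polynomial.rootSum {K : Type*} [Field K] (f : K → ℚ) (p : Polynomial K) : ℚ :=
  (p.roots.map f).sum

theorem Polynomial.rootSum_prod {K ι : Type*} [Field K] (f : K → ℚ) (s : Finset ι)
    (p : ι → Polynomial K) (hp : ∀ i ∈ s, p i ≠ 0) :
    (∏ i ∈ s, p i).rootSum f = ∑ i ∈ s, (p i).rootSum f := by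
  rw [rootSum, Polynomial.roots_prod _ _ (Finset.prod_ne_zero_iff.2 hp), Multiset.map_bind,
    Multiset.sum_bind]
  rfl

theorem map_multiset_prod_of_ne_zero {K : Type*} [Field K] {f : K → ℚ}
    (hf : ∀ x y, x ≠ 0 → y ≠ 0 → f (x * y) = f x + f y) (s : Multiset K) (hs : (0 : K) ∉ s) :
    f s.prod = (s.map f).sum := by
  induction s using Multiset.induction_on with
  | empty =>
    have := hf 1 1 one_ne_zero one_ne_zero
    simpa using this
  | cons a s ih =>
    rw [Multiset.mem_cons, not_or] at hs
    rw [Multiset.prod_cons, hf _ _ (Ne.symm hs.1) (Multiset.prod_ne_zero hs.2), ih hs.2,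
      Multiset.map_cons, Multiset.sum_cons]

theorem LinearMap.rootSum_charpoly_eq_zero_of_det_eq_one {K V : Type*} [Field K] [IsAlgClosed K]
    [AddCommGroup V] [Module K V] [FiniteDimensional K V] {f : K → ℚ}
    (hf : ∀ x y, x ≠ 0 → y ≠ 0 → f (x * y) = f x + f y) {B : Module.End K V}
    (hB : LinearMap.det B = 1) : B.charpoly.rootSum f = 0 ∧ (0 : K) ∉ B.charpoly.roots := by
  have hprod : B.charpoly.roots.prod = 1 := by
    rw [← Module.End.det_eq_prod_roots_charpoly_of_splits (IsAlgClosed.splits _), hB]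
  have h0 : (0 : K) ∉ B.charpoly.roots := fun h => by
    rw [Multiset.prod_eq_zero h] at hprod
    exact zero_ne_one hprod
  refine ⟨?_, h0⟩
  rw [Polynomial.rootSum, ← map_multiset_prod_of_ne_zero hf _ h0, hprod]
  simpa using hf 1 1 one_ne_zero one_ne_zero

theorem LinearMap.card_roots_charpoly {K V : Type*} [Field K] [IsAlgClosed K]
    [AddCommGroup V] [Module K V] [FiniteDimensional K V] (B : Module.End K V) :
    B.charpoly.roots.card = Module.finrank K V := by
  rw [← (IsAlgClosed.splits _).natDegree_eq_card_roots, LinearMap.charpoly_natDegree]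

theorem LinearMap.rootSum_charpoly_mul_of_isNilpotent_sub {K V : Type*} [Field K]
    [IsAlgClosed K] [AddCommGroup V] [Module K V] [FiniteDimensional K V] {f : K → ℚ}
    (hf : ∀ x y, x ≠ 0 → y ≠ 0 → f (x * y) = f x + f y) {A B : Module.End K V}
    (h : Commute A B) {a : K} (ha : a ≠ 0) (hA : IsNilpotent (A - algebraMap K _ a))
    (hB : LinearMap.det B = 1) :
    (A * B).charpoly.rootSum (f · ^ 2) =
      A.charpoly.rootSum (f · ^ 2) + B.charpoly.rootSum (f · ^ 2) := by
  obtain ⟨hsum, h0⟩ := rootSum_charpoly_eq_zero_of_det_eq_one hf hB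
  have hAr := roots_charpoly_mul_of_isNilpotent_sub (Commute.one_right A) ha hA
  have h1 : (1 : Module.End K V).charpoly.roots =
      Multiset.replicate (Module.finrank K V) (1 : K) := by
    rw [LinearMap.charpoly_one, ← Polynomial.C_1, Polynomial.roots_pow, Polynomial.roots_X_sub_C,
      Multiset.nsmul_singleton]
  rw [mul_one, h1, Multiset.map_replicate, mul_one] at hAr
  rw [Polynomial.rootSum, Polynomial.rootSum, hAr, roots_charpoly_mul_of_isNilpotent_sub h ha hA,
    Multiset.map_map, Multiset.map_replicate, Multiset.sum_replicate, ← card_roots_charpoly B,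
    Polynomial.rootSum]
  rw [Polynomial.rootSum] at hsum
  have : B.charpoly.roots.map ((f · ^ 2) ∘ (a * ·)) =
      B.charpoly.roots.map fun b => (f a ^ 2 + 2 * f a * f b) + f b ^ 2 := by
    refine Multiset.map_congr rfl fun b hb => ?_
    simp only [Function.comp]
    rw [hf a b ha (fun hb0 => h0 (hb0 ▸ hb))]
    ring
  rw [this, Multiset.sum_map_add, Multiset.sum_map_add, Multiset.sum_map_mul_left, hsum,
    mul_zero, add_zero]
  simp

theorem LinearMap.rootSum_charpoly_mul {K V : Type*} [Field K]
    [IsAlgClosed K] [AddCommGroup V] [Module K V] [FiniteDimensional K V] {f : K → ℚ}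
    (hf : ∀ x y, x ≠ 0 → y ≠ 0 → f (x * y) = f x + f y) {A B : Module.End K V}
    (hA : Function.Injective A) (h : Commute A B)
    (hB : ∀ a (hm : Set.MapsTo B (A.maxGenEigenspace a) (A.maxGenEigenspace a)),
      LinearMap.det (B.restrict hm) = 1) :
    (A * B).charpoly.rootSum (f · ^ 2) =
      A.charpoly.rootSum (f · ^ 2) + B.charpoly.rootSum (f · ^ 2) := by
  classical
  have hInt : DirectSum.IsInternal A.maxGenEigenspace :=
    (DirectSum.isInternal_submodule_iff_iSupIndep_and_iSup_eq_top _).2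
      ⟨A.independent_maxGenEigenspace, A.iSup_maxGenEigenspace_eq_top⟩
  have hInt' := DirectSum.isInternal_ne_bot_iff.2 hInt
  have hfin : {a | A.maxGenEigenspace a ≠ ⊥}.Finite :=
    WellFoundedGT.finite_ne_bot_of_iSupIndep A.independent_maxGenEigenspace
  let _ : Fintype {a // A.maxGenEigenspace a ≠ ⊥} := hfin.fintype
  have hmA : ∀ a, Set.MapsTo A (A.maxGenEigenspace a) (A.maxGenEigenspace a) :=
    fun a => Module.End.mapsTo_maxGenEigenspace_of_comm (Commute.refl A) a
  have hmB : ∀ a, Set.MapsTo B (A.maxGenEigenspace a) (A.maxGenEigenspace a) :=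
    fun a => Module.End.mapsTo_maxGenEigenspace_of_comm h a
  have hmAB : ∀ a, Set.MapsTo (A * B) (A.maxGenEigenspace a) (A.maxGenEigenspace a) :=
    fun a => (hmA a).comp (hmB a)
  rw [charpoly_eq_prod_charpoly_restrict hInt' (fun i => hmA i),
    charpoly_eq_prod_charpoly_restrict hInt' (fun i => hmB i),
    charpoly_eq_prod_charpoly_restrict hInt' (fun i => hmAB i),
    Polynomial.rootSum_prod _ _ _ fun i _ => (LinearMap.charpoly_monic _).ne_zero,
    Polynomial.rootSum_prod _ _ _ fun i _ => (LinearMap.charpoly_monic _).ne_zero,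
    Polynomial.rootSum_prod _ _ _ fun i _ => (LinearMap.charpoly_monic _).ne_zero,
    ← Finset.sum_add_distrib]
  refine Finset.sum_congr rfl fun i _ => ?_
  obtain ⟨a, hne⟩ := i
  have ha : a ≠ 0 := by
    rintro rfl
    refine hne ((Submodule.eq_bot_iff _).2 fun x hx => ?_)
    rw [Module.End.mem_maxGenEigenspace] at hx
    obtain ⟨k, hk⟩ := hx
    rw [zero_smul, sub_zero, Module.End.pow_apply] at hk
    exact hA.iterate k (by rw [hk, ← Module.End.pow_apply, map_zero])
  have hc : Commute (A.restrict (hmA a)) (B.restrict (hmB a)) :=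
    LinearMap.ext fun x => Subtype.ext (DFunLike.congr_fun h x.1)
  refine Eq.trans ?_ (rootSum_charpoly_mul_of_isNilpotent_sub hf hc ha ?_ (hB a _))
  · rfl
  · have := Module.End.isNilpotent_restrict_maxGenEigenspace_sub_algebraMap A a
    convert this using 1
    rfl

theorem exists_map_mul_eq_add_ne_zero {K : Type*} [Field K] {b : K} (hb : b ≠ 0)
    (hb' : ∀ N > 0, b ^ N ≠ 1) :
    ∃ f : K → ℚ, (∀ x y, x ≠ 0 → y ≠ 0 → f (x * y) = f x + f y) ∧ f b ≠ 0 := by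
  classical
  have hinj : Function.Injective (zmultiplesHom (Additive Kˣ) (.ofMul (Units.mk0 b hb))) := by
    rw [injective_iff_map_eq_zero]
    intro n hn
    have h1 : (Units.mk0 b hb) ^ n = 1 := hn
    by_contra hn0
    have h2 : (Units.mk0 b hb) ^ n.natAbs = 1 := by
      rcases Int.natAbs_eq n with h | h
      · rw [h, zpow_natCast] at h1
        exact h1
      · rw [h, zpow_neg, zpow_natCast, inv_eq_one] at h1
        exact h1
    refine hb' n.natAbs (Int.natAbs_pos.2 hn0) ?_
    simpa using congrArg Units.val h2
  obtain ⟨g, hg⟩ := Module.Baer.extension_property_addMonoidHom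
    (Module.Baer.of_divisible ℚ : Module.Baer ℤ ℚ) _ hinj (zmultiplesHom ℚ 1)
  refine ⟨fun x => if hx : x = 0 then 0 else g (.ofMul (Units.mk0 x hx)), fun x y hx hy => ?_, ?_⟩
  · simp only [hx, hy, mul_ne_zero hx hy, dite_false]
    rw [← map_add, ← ofMul_mul]
    congr
    ext
    simp
  · have := DFunLike.congr_fun hg 1
    simp only [AddMonoidHom.comp_apply, zmultiplesHom_apply, one_smul] at this
    simp [hb, this]

theorem Module.End.det_eq_one_of_mem_commutator {K W G : Type*} [Field K] [AddCommGroup W]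
    [Module K W] [Group G] (s : G →* Module.End K W) {g : G} (hg : g ∈ commutator G) :
    LinearMap.det (s g) = 1 := by
  have h := Abelianization.commutator_subset_ker (MonoidHom.toHomUnits (LinearMap.det.comp s)) hg
  rw [MonoidHom.mem_ker] at h
  simpa using congrArg Units.val h

/-- The restriction of a representation to an invariant subspace. -/
def Module.End.restrictHom {K V G : Type*} [Field K] [AddCommGroup V]
    [Module K V] [Group G] (s : G →* Module.End K V) (W : Submodule K V)
    (h : ∀ g, Set.MapsTo (s g) W W) : G →* Module.End K W where
  toFun g := (s g).restrict (h g)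
  map_one' := by ext; simp
  map_mul' a b := by ext; simp; rfl

theorem Module.End.exists_pow_eq_one_of_mem_commutator {K V G : Type*} [Field K]
    [IsAlgClosed K] [AddCommGroup V] [Module K V] [FiniteDimensional K V] [Group G]
    (s : G →* Module.End K V) {A : Module.End K V} (hA : Function.Injective A)
    (h : ∀ g, Commute A (s g)) {g : G} (hg : g ∈ commutator G)
    (hconj : (A * s g).charpoly = A.charpoly) {b : K} (hb : b ∈ (s g).charpoly.roots) :
    ∃ N > 0, b ^ N = 1 := by
  by_contra! hN
  have h0 : b ≠ 0 := by
    rintro rfl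
    have hp := Multiset.prod_eq_zero hb
    rw [← Module.End.det_eq_prod_roots_charpoly_of_splits (IsAlgClosed.splits _),
      det_eq_one_of_mem_commutator s hg] at hp
    exact one_ne_zero hp
  obtain ⟨f, hf, hfb⟩ := exists_map_mul_eq_add_ne_zero h0 hN
  have key := LinearMap.rootSum_charpoly_mul hf hA (h g) (fun a hm =>
    det_eq_one_of_mem_commutator (restrictHom s _ fun g =>
      Module.End.mapsTo_maxGenEigenspace_of_comm (h g) a) hg)
  rw [hconj, left_eq_add, Polynomial.rootSum] at key
  have hle := Multiset.single_le_sum (s := (s g).charpoly.roots.map (f · ^ 2))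
    (by simp only [Multiset.mem_map]; rintro _ ⟨x, -, rfl⟩; positivity) (f b ^ 2)
    (Multiset.mem_map_of_mem _ hb)
  rw [key] at hle
  exact hfb (pow_eq_zero_iff two_ne_zero |>.1 (le_antisymm hle (sq_nonneg _)))

theorem IntermediateField.finite_sums_of_pow_eq_one {L : Type*} [Field L] [Algebra ℚ L]
    [Algebra.IsAlgebraic ℚ L] (k : IntermediateField ℚ L) [FiniteDimensional ℚ k] (n : ℕ) :
    {x : L | x ∈ k ∧ ∃ m : Multiset L, m.card = n ∧ (∀ b ∈ m, ∃ N > 0, b ^ N = 1) ∧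
      m.sum = x}.Finite := by
  have : CharZero k := algebraRat.charZero k
  have : NumberField k := by
    refine @NumberField.mk _ _ this ?_
    have h : (DivisionRing.toRatAlgebra : Algebra ℚ k) = k.algebra' := Subsingleton.elim _ _
    rw [h]
    infer_instance
  refine ((NumberField.Embeddings.finite_of_norm_le k ℂ n).image (algebraMap k L)).subset ?_
  rintro x ⟨hx, m, rfl, hm, rfl⟩
  refine ⟨⟨m.sum, hx⟩, ⟨?_, fun φ => ?_⟩, rfl⟩
  · rw [← isIntegral_algebraMap_iff (algebraMap k L).injective]
    refine IsIntegral.multiset_sum fun b hb => ?_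
    obtain ⟨N, hN, h1⟩ := hm b hb
    exact IsIntegral.of_pow hN (h1 ▸ isIntegral_one)
  · let _ := φ.toAlgebra
    have : Algebra.IsAlgebraic k L := Algebra.IsAlgebraic.tower_top (K := ℚ) k
    let ψ : L →ₐ[k] ℂ := IsAlgClosed.lift
    have hψ : φ ⟨m.sum, hx⟩ = (m.map ψ).sum := by
      rw [← map_multiset_sum]
      exact (ψ.commutes ⟨m.sum, hx⟩).symm
    rw [hψ]
    refine (norm_multiset_sum_le _).trans ?_
    have h1 : ∀ b ∈ m, ‖ψ b‖ = 1 := fun b hb => by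
      obtain ⟨N, hN, h1⟩ := hm b hb
      exact Complex.norm_eq_one_of_pow_eq_one (by rw [← map_pow, h1, map_one]) hN.ne'
    rw [Multiset.map_map, Function.comp_def, Multiset.map_congr rfl (g := fun _ => (1 : ℝ)) h1]
    simp

theorem FreeGroup.exists_finiteDimensional_forall_mem {α F L T : Type*} [Finite α] [Field F]
    [Field L] [Algebra F L] [Algebra.IsAlgebraic F L] [Finite T] (χ : FreeGroup α → T → L)
    (hχ : ∀ (Q : Finset (FreeGroup α)) (d : FreeGroup α → L) (w u : FreeGroup α),
      ∑ q ∈ Q, d q • χ q = χ w → ∑ q ∈ Q, d q • χ (u * q) = χ (u * w)) :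
    ∃ k : IntermediateField F L, FiniteDimensional F k ∧ ∀ w t, χ w t ∈ k := by
  classical
  obtain ⟨Q, hQ⟩ : ∃ Q : Finset (FreeGroup α), ∀ w, ∃ d : FreeGroup α → L,
      ∑ q ∈ Q, d q • χ q = χ w := by
    obtain ⟨s, hs, hs'⟩ := (Submodule.fg_span_iff_fg_span_finset_subset (R := L)
      (Set.range χ)).1 (IsNoetherian.noetherian _)
    rw [← Set.image_univ, Finset.subset_set_image_iff] at hs
    obtain ⟨Q, -, rfl⟩ := hs
    refine ⟨Q, fun w => ?_⟩
    have hw : χ w ∈ Submodule.span L (Set.range χ) := Submodule.subset_span ⟨w, rfl⟩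
    rw [hs', Finset.coe_image, Submodule.mem_span_image_finset_iff_exists_fun] at hw
    obtain ⟨c, hc⟩ := hw
    refine ⟨fun w => if h : w ∈ Q then c ⟨w, h⟩ else 0, ?_⟩
    rw [← hc, ← Finset.sum_coe_sort]
    simp
  choose C hC using hQ
  let S : Set L := (⋃ q ∈ Q, {C 1 q}) ∪ (⋃ a : α, ⋃ q ∈ Q, ⋃ q' ∈ Q, {C (of a * q) q'}) ∪
    (⋃ a : α, ⋃ q ∈ Q, ⋃ q' ∈ Q, {C ((of a)⁻¹ * q) q'}) ∪ ⋃ q ∈ Q, Set.range (χ q)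
  have hS : S.Finite := by
    refine Set.Finite.union (Set.Finite.union (Set.Finite.union ?_ ?_) ?_) ?_
    · exact Q.finite_toSet.biUnion fun _ _ => Set.finite_singleton _
    · exact Set.finite_iUnion fun _ => Q.finite_toSet.biUnion fun _ _ =>
        Q.finite_toSet.biUnion fun _ _ => Set.finite_singleton _
    · exact Set.finite_iUnion fun _ => Q.finite_toSet.biUnion fun _ _ =>
        Q.finite_toSet.biUnion fun _ _ => Set.finite_singleton _
    · exact Q.finite_toSet.biUnion fun _ _ => Set.finite_range _
  let k := IntermediateField.adjoin F S
  have hSk : S ⊆ k := IntermediateField.subset_adjoin F S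
  have key : ∀ u, ∀ q ∈ Q, ∃ d : FreeGroup α → L, (∀ q' ∈ Q, d q' ∈ k) ∧
      ∑ q' ∈ Q, d q' • χ q' = χ (u * q) := by
    intro u
    induction u using FreeGroup.induction_on with
    | C1 =>
      intro q hq
      refine ⟨Pi.single q 1, fun q' _ => ?_, ?_⟩
      · by_cases h : q' = q
        · subst h
          simp
        · simp [h]
      · rw [Finset.sum_eq_single_of_mem q hq fun b _ hb => by simp [hb]]
        simp
    | of a =>
      exact fun q hq =>
        ⟨C (of a * q), fun q' hq' => hSk (.inl (.inl (.inr (by simp; grind)))), hC _⟩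
    | inv_of a _ =>
      exact fun q hq => ⟨C ((of a)⁻¹ * q), fun q' hq' => hSk (.inl (.inr (by simp; grind))), hC _⟩
    | mul u v hu hv =>
      intro q hq
      obtain ⟨d, hd, hd'⟩ := hv q hq
      choose! e he he' using hu
      refine ⟨fun q' => ∑ p ∈ Q, d p * e p q',
        fun q' hq' => sum_mem fun p hp => mul_mem (hd p hp) (he p hp q' hq'), ?_⟩
      rw [mul_assoc, ← hχ Q d _ u hd']
      simp_rw [Finset.sum_smul]
      rw [Finset.sum_comm]
      refine Finset.sum_congr rfl fun p hp => ?_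
      simp_rw [mul_smul]
      rw [← Finset.smul_sum, he' p hp]
  refine ⟨k, ?_, fun w t => ?_⟩
  · have := hS.to_subtype
    exact IntermediateField.finiteDimensional_adjoin fun x _ => Algebra.IsIntegral.isIntegral x
  · have h1 := hχ Q (C 1) 1 w (hC 1)
    rw [mul_one] at h1
    rw [← h1, Finset.sum_apply]
    refine sum_mem fun q hq => mul_mem (hSk (.inl (.inl (.inl (by simp; grind))))) ?_
    obtain ⟨d, hd, hd'⟩ := key w q hq
    rw [← hd', Finset.sum_apply]
    exact sum_mem fun q' hq' => mul_mem (hd q' hq') (hSk (.inr (by simp; grind)))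

theorem Module.End.isNilpotent_of_trace_mul_aeval_eq_zero {K V : Type*} [Field K] [CharZero K]
    [AddCommGroup V] [Module K V] [FiniteDimensional K V] {z : Module.End K V}
    (hz : ∀ p : Polynomial K, LinearMap.trace K V (z * Polynomial.aeval z p) = 0) :
    IsNilpotent z := by
  obtain ⟨q, hq, hq0⟩ := Polynomial.exists_eq_pow_rootMultiplicity_mul_and_not_dvd z.charpoly
    (LinearMap.charpoly_monic z).ne_zero 0
  rw [Polynomial.C_0, sub_zero] at hq hq0
  set a := z.charpoly.rootMultiplicity 0
  have hX : IsCoprime (Polynomial.X ^ (a + 1)) q :=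
    (Polynomial.irreducible_X.coprime_iff_not_dvd.2 hq0).pow_left
  obtain ⟨u, v, huv⟩ := hX
  have h1 : (u * Polynomial.X ^ (a + 1)) * (u * Polynomial.X ^ (a + 1)) =
      u * Polynomial.X ^ (a + 1) - u * Polynomial.X * v * z.charpoly := by
    rw [hq]
    linear_combination (u * Polynomial.X ^ (a + 1)) * huv
  have h2 : u * Polynomial.X ^ (a + 1) = Polynomial.X * (Polynomial.X ^ a * u) := by ring
  have h3 : (Polynomial.X : Polynomial K) ^ a =
      Polynomial.X ^ a * (u * Polynomial.X ^ (a + 1)) + v * z.charpoly := by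
    rw [hq]
    linear_combination -Polynomial.X ^ a * huv
  have he : Polynomial.aeval z (u * Polynomial.X ^ (a + 1)) = 0 := by
    refine LinearMap.IsIdempotentElem.eq_zero_of_trace_eq_zero ?_ ?_
    · rw [IsIdempotentElem, ← map_mul, h1, map_sub, map_mul _ _ z.charpoly,
        LinearMap.aeval_self_charpoly, mul_zero, sub_zero]
    · rw [h2, map_mul, Polynomial.aeval_X]
      exact hz _
  refine ⟨a, ?_⟩
  have h4 := congrArg (Polynomial.aeval z) h3
  rwa [map_add, map_mul, map_mul _ v, he, LinearMap.aeval_self_charpoly, mul_zero, mul_zero,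
    add_zero, map_pow, Polynomial.aeval_X] at h4

theorem Subalgebra.mem_jacobson_of_trace_eq_zero {K V : Type*} [Field K] [CharZero K]
    [AddCommGroup V] [Module K V] [FiniteDimensional K V] (A : Subalgebra K (Module.End K V))
    (x : A) (hx : ∀ y ∈ A, LinearMap.trace K V (x * y) = 0) : x ∈ Ring.jacobson A := by
  rw [← Ideal.jacobson_bot, Ideal.mem_jacobson_iff]
  intro y
  have hnil : IsNilpotent (y * x) := by
    rw [← IsNilpotent.map_iff (f := A.val) Subtype.val_injective]
    refine Module.End.isNilpotent_of_trace_mul_aeval_eq_zero fun p => ?_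
    have h : A.val (y * x) * Polynomial.aeval (A.val (y * x)) p =
        y * (x * Polynomial.aeval (A.val (y * x)) p) := by
      rw [← mul_assoc]
      rfl
    rw [h, LinearMap.trace_mul_comm, mul_assoc]
    refine hx _ (mul_mem ?_ y.2)
    rw [Polynomial.aeval_algHom_apply]
    exact Subtype.prop _
  obtain ⟨z, hz⟩ := hnil.isUnit_add_one.exists_left_inv
  refine ⟨z, ?_⟩
  rw [Ideal.mem_bot, sub_eq_zero, ← hz, mul_add, mul_one, mul_assoc]

/-- The left-normed iterated commutator `[a, [a, …, [a, b]]]`. -/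
def iteratedCommutator {G : Type*} [Group G] (a b : G) : ℕ → G
  | 0 => b
  | k + 1 => ⁅a, iteratedCommutator a b k⁆

theorem map_iteratedCommutator_sub_one_mem {G R : Type*} [Group G] [Ring R] (I : Ideal R)
    [I.IsTwoSided] (r : G →* R) {a b : G} (ha : r a - 1 ∈ I) (hb : r b - 1 ∈ I) (k : ℕ) :
    r (iteratedCommutator a b k) - 1 ∈ I ^ (k + 1) := by
  induction k with
  | zero => simpa [iteratedCommutator, Submodule.pow_one] using hb
  | succ k ih =>
    set c := iteratedCommutator a b k
    have h : r (iteratedCommutator a b (k + 1)) - 1 =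
        ((r a - 1) * (r c - 1) - (r c - 1) * (r a - 1)) * r (a⁻¹ * c⁻¹) := by
      have h1 : (r a - 1) * (r c - 1) - (r c - 1) * (r a - 1) = r (a * c) - r (c * a) := by
        rw [map_mul, map_mul]
        noncomm_ring
      rw [h1, sub_mul, ← map_mul, ← map_mul]
      simp [iteratedCommutator, commutatorElement_def, c, mul_assoc]
    rw [h]
    refine Ideal.mul_mem_right _ _ (Ideal.sub_mem _ ?_ ?_)
    · rw [Submodule.pow_succ' _ k.succ_ne_zero]
      exact Ideal.mul_mem_mul ha ih
    · rw [Submodule.pow_succ]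
      exact Ideal.mul_mem_mul ih ha

theorem FreeGroup.iteratedCommutator_pow_ne_one {p q : ℕ} (hp : 0 < p) (hq : 0 < q) (k : ℕ) :
    iteratedCommutator ((of 0 : FreeGroup (Fin 2)) ^ p) (of 1 ^ q) k ≠ 1 := by
  let θ : FreeGroup (Fin 2) →* Equiv.Perm ℚ :=
    FreeGroup.lift ![Equiv.mulLeft₀ 2 two_ne_zero, Equiv.addRight 1]
  have h0 : ∀ x, θ (of 0 ^ p) x = 2 ^ p * x := by
    intro x
    simp only [θ, map_pow, FreeGroup.lift_apply_of, Matrix.cons_val]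
    clear hp
    induction p generalizing x with
    | zero => simp
    | succ p ih => rw [pow_succ, Equiv.Perm.mul_apply, ih, pow_succ]; simp [mul_assoc]
  have h1 : ∀ x, θ (of 1 ^ q) x = x + q := by
    intro x
    simp only [θ, map_pow, FreeGroup.lift_apply_of, Matrix.cons_val]
    clear hq
    induction q generalizing x with
    | zero => simp
    | succ p ih => rw [pow_succ, Equiv.Perm.mul_apply, ih]; simp; ring
  have key : ∀ x, θ (iteratedCommutator (of 0 ^ p) (of 1 ^ q) k) x =
      x + (2 ^ p - 1) ^ k * q := by
    induction k with
    | zero => simpa [iteratedCommutator] using h1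
    | succ k ih =>
      intro x
      have h0' : ∀ x, (θ (of 0 ^ p))⁻¹ x = x / 2 ^ p := fun x => by
        rw [Equiv.Perm.inv_eq_iff_eq, h0]
        field_simp
      have ih' : ∀ x, (θ (iteratedCommutator (of 0 ^ p) (of 1 ^ q) k))⁻¹ x =
          x - (2 ^ p - 1) ^ k * q := fun x => by
        rw [Equiv.Perm.inv_eq_iff_eq, ih]
        ring
      rw [iteratedCommutator, map_commutatorElement, commutatorElement_def]
      simp only [Equiv.Perm.mul_apply]
      rw [ih', h0', ih, h0]
      field_simp
      ring
  intro h
  have h2 := key 0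
  rw [h, _root_.map_one, Equiv.Perm.one_apply, zero_add] at h2
  have h3 : (1 : ℚ) < 2 ^ p := one_lt_pow₀ one_lt_two hp.ne'
  have h4 : (0 : ℚ) < (2 ^ p - 1) ^ k * q :=
    mul_pos (pow_pos (sub_pos.2 h3) _) (Nat.cast_pos.2 hq)
  exact h4.ne h2

theorem MonoidHom.exists_finset_forall_linearMap_eq_zero (K : Type*) {R G : Type*} [Field K]
    [Ring R] [Algebra K R] [FiniteDimensional K R] [Group G] (r : G →* R) :
    ∃ T : Finset G, 1 ∈ T ∧ ∀ φ : R →ₗ[K] K, (∀ t ∈ T, φ (r t) = 0) →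
      ∀ y ∈ Algebra.adjoin K (Set.range r), φ y = 0 := by
  classical
  obtain ⟨s, hs, hs'⟩ := (Submodule.fg_span_iff_fg_span_finset_subset (R := K)
      (Set.range r)).1 (IsNoetherian.noetherian _)
  rw [← Set.image_univ, Finset.subset_set_image_iff] at hs
  obtain ⟨T, -, rfl⟩ := hs
  refine ⟨insert 1 T, Finset.mem_insert_self _ _, fun φ hφ y hy => ?_⟩
  have hspan : Subalgebra.toSubmodule (Algebra.adjoin K (Set.range r)) =
      Submodule.span K (r '' T) := by
    rw [Algebra.adjoin_eq_span, ← Finset.coe_image, ← hs', ← MonoidHom.coe_mrange,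
      Submonoid.closure_eq]
  have hy' : y ∈ Submodule.span K (r '' T) := hspan ▸ (Subalgebra.mem_toSubmodule _).2 hy
  have hle : Submodule.span K (r '' T) ≤ LinearMap.ker φ := by
    rw [Submodule.span_le]
    rintro _ ⟨t, ht, rfl⟩
    exact hφ t (Finset.mem_insert_of_mem ht)
  exact hle hy'

theorem FreeGroup.not_injective_of_finite_range_trace {K V : Type*} [Field K] [CharZero K]
    [AddCommGroup V] [Module K V] [FiniteDimensional K V]
    (r : FreeGroup (Fin 2) →* Module.End K V)
    (hfin : (Set.range fun w => LinearMap.trace K V (r w)).Finite) :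
    ¬ Function.Injective r := by
  intro hinj
  obtain ⟨T, -, hT⟩ := r.exists_finset_forall_linearMap_eq_zero K
  let A := Algebra.adjoin K (Set.range r)
  have hA : ∀ w, r w ∈ A := fun w => Algebra.subset_adjoin ⟨w, rfl⟩
  let rA : FreeGroup (Fin 2) →* A := r.codRestrict A hA
  have hpow : ∀ w : FreeGroup (Fin 2), ∃ p > 0, rA (w ^ p) - 1 ∈ Ring.jacobson A := by
    intro w
    have := hfin.to_subtype
    obtain ⟨i, j, hij, h⟩ := Finite.exists_ne_map_eq_of_infinite
      (fun (i : ℕ) (t : T) => (⟨_, w ^ i * t, rfl⟩ :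
        Set.range fun w => LinearMap.trace K V (r w)))
    wlog hlt : i < j generalizing i j
    · exact this j i hij.symm h.symm (lt_of_le_of_ne (not_lt.1 hlt) hij.symm)
    refine ⟨j - i, Nat.sub_pos_of_lt hlt, Subalgebra.mem_jacobson_of_trace_eq_zero A _ ?_⟩
    have h0 := hT ((LinearMap.trace K V).comp (LinearMap.mulLeft K (r (w ^ j) - r (w ^ i))))
      fun t ht => by
        have := congrArg Subtype.val (congrFun h ⟨t, ht⟩)
        simp only [_root_.map_mul] at this
        rw [LinearMap.comp_apply, LinearMap.mulLeft_apply, sub_mul, map_sub, this, sub_self]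
    intro y hy
    have h1 := h0 (r ((w ^ i)⁻¹) * y) (mul_mem (hA _) hy)
    rw [LinearMap.comp_apply, LinearMap.mulLeft_apply, ← mul_assoc, sub_mul, ← _root_.map_mul,
      ← _root_.map_mul, mul_inv_cancel, _root_.map_one, ← pow_sub _ hlt.le] at h1
    exact h1
  obtain ⟨p, hp, hp'⟩ := hpow (of 0)
  obtain ⟨q, hq, hq'⟩ := hpow (of 1)
  have : IsArtinianRing A := IsArtinianRing.of_finite K A
  obtain ⟨m, hm⟩ : IsNilpotent (Ring.jacobson A) := IsSemiprimaryRing.isNilpotent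
  have h := map_iteratedCommutator_sub_one_mem (Ring.jacobson A) rA hp' hq' m
  rw [Submodule.pow_succ, hm, Ideal.zero_eq_bot, Ideal.bot_mul, Ideal.mem_bot, sub_eq_zero] at h
  refine iteratedCommutator_pow_ne_one hp hq m (hinj ?_)
  rw [_root_.map_one]
  exact congrArg Subtype.val h

theorem FreeGroup.finite_range_trace {K V : Type*} [Field K] [IsAlgClosed K] [CharZero K]
    [AddCommGroup V] [Module K V] [FiniteDimensional K V]
    (r : FreeGroup (Fin 2) →* Module.End K V)
    (hr : ∀ w, ∀ b ∈ (r w).charpoly.roots, ∃ N > 0, b ^ N = 1) :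
    (Set.range fun w => LinearMap.trace K V (r w)).Finite := by
  let L := algebraicClosure ℚ K
  have hL : Algebra.IsAlgebraic ℚ L := algebraicClosure.isAlgebraic ℚ K
  have hsum : ∀ w, ∃ m : Multiset L, m.card = Module.finrank K V ∧
      (∀ b ∈ m, ∃ N > 0, b ^ N = 1) ∧ algebraMap L K m.sum = LinearMap.trace K V (r w) := by
    intro w
    have hmem : ∀ b ∈ (r w).charpoly.roots, b ∈ L := fun b hb => by
      obtain ⟨N, hN, h1⟩ := hr w b hb
      rw [mem_algebraicClosure_iff']
      exact IsIntegral.of_pow hN (h1 ▸ isIntegral_one)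
    refine ⟨(r w).charpoly.roots.attach.map fun b => ⟨b.1, hmem b.1 b.2⟩, ?_, ?_, ?_⟩
    · rw [Multiset.card_map, Multiset.card_attach, LinearMap.card_roots_charpoly]
    · simp only [Multiset.mem_map]
      rintro _ ⟨b, -, rfl⟩
      obtain ⟨N, hN, h1⟩ := hr w b.1 b.2
      exact ⟨N, hN, Subtype.ext h1⟩
    · rw [map_multiset_sum, Multiset.map_map,
        Module.End.trace_eq_sum_roots_charpoly_of_splits (IsAlgClosed.splits _)]
      exact congrArg Multiset.sum (Multiset.attach_map_val _)
  choose m hcard hm htr using hsum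
  obtain ⟨T, h1T, hT⟩ := r.exists_finset_forall_linearMap_eq_zero K
  have hχ : ∀ (Q : Finset (FreeGroup (Fin 2))) (d : FreeGroup (Fin 2) → L)
      (w u : FreeGroup (Fin 2)),
      ∑ q ∈ Q, d q • (fun t : T => (m (q * t)).sum) = (fun t : T => (m (w * t)).sum) →
      ∑ q ∈ Q, d q • (fun t : T => (m (u * q * t)).sum) = fun t : T => (m (u * w * t)).sum := by
    intro Q d w u h
    let Z : Module.End K V := ∑ q ∈ Q, algebraMap L K (d q) • r q - r w
    have hZ : ∀ v x, LinearMap.trace K V (r v * Z * r x) =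
        ∑ q ∈ Q, algebraMap L K (d q * (m (v * q * x)).sum) -
          algebraMap L K (m (v * w * x)).sum := by
      intro v x
      simp only [Z, mul_sub, sub_mul, Finset.mul_sum, Finset.sum_mul, map_sub, map_sum,
        mul_smul_comm, smul_mul_assoc, map_smul, _root_.map_mul, htr, smul_eq_mul]
    have h0 := hT ((LinearMap.trace K V).comp (LinearMap.mulLeft K Z)) fun t ht => by
      have h2 := hZ 1 t
      simp only [_root_.map_one, one_mul] at h2
      rw [LinearMap.comp_apply, LinearMap.mulLeft_apply, h2, ← map_sum, ← map_sub]
      have h3 := congrFun h ⟨t, ht⟩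
      simp only [Finset.sum_apply, Pi.smul_apply, smul_eq_mul] at h3
      simp [h3]
    funext t
    simp only [Finset.sum_apply, Pi.smul_apply, smul_eq_mul]
    apply (algebraMap L K).injective
    rw [map_sum, ← sub_eq_zero, ← hZ, mul_assoc, LinearMap.trace_mul_comm, mul_assoc]
    exact h0 _ (mul_mem (Algebra.subset_adjoin ⟨_, rfl⟩) (Algebra.subset_adjoin ⟨_, rfl⟩))
  obtain ⟨k, hk, hmem⟩ := exists_finiteDimensional_forall_mem (F := ℚ)
    (fun (w : FreeGroup (Fin 2)) (t : T) => (m (w * t)).sum) hχ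
  refine ((k.finite_sums_of_pow_eq_one (Module.finrank K V)).image (algebraMap L K)).subset ?_
  rintro _ ⟨w, rfl⟩
  refine ⟨(m w).sum, ⟨?_, m w, hcard w, hm w, rfl⟩, htr w⟩
  simpa using hmem w ⟨1, h1T⟩

theorem Module.End.exists_pow_eq_one_of_charP {K V : Type*} [Field K] [IsAlgClosed K]
    [AddCommGroup V] [Module K V] [FiniteDimensional K V] (p : ℕ) [Fact p.Prime] [CharP K p]
    (B : Module.End K V) (hB : ∀ b ∈ B.charpoly.roots, ∃ N > 0, b ^ N = 1) :
    ∃ N > 0, B ^ N = 1 := by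
  classical
  obtain ⟨N, hN, hN1⟩ : ∃ N > 0, ∀ b ∈ B.charpoly.roots, b ^ N = 1 := by
    choose! f hf hf1 using hB
    refine ⟨∏ b ∈ B.charpoly.roots.toFinset, f b,
      Finset.prod_pos fun b hb => hf b (Multiset.mem_toFinset.1 hb), fun b hb => ?_⟩
    rw [← Finset.mul_prod_erase _ _ (Multiset.mem_toFinset.2 hb), pow_mul, hf1 b hb, one_pow]
  have hdvd : B.charpoly ∣ (Polynomial.X ^ N - 1) ^ Module.finrank K V := by
    rw [← LinearMap.card_roots_charpoly B]
    conv_lhs => rw [(IsAlgClosed.splits B.charpoly).eq_prod_roots_of_monic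
      (LinearMap.charpoly_monic B)]
    rw [← Multiset.prod_replicate, ← Multiset.map_const']
    refine Multiset.prod_dvd_prod_of_dvd _ _ fun b hb => ?_
    rw [Polynomial.dvd_iff_isRoot]
    simp [hN1 b hb]
  have h0 : (B ^ N - 1) ^ Module.finrank K V = 0 := by
    obtain ⟨c, hc⟩ := hdvd
    have := congrArg (Polynomial.aeval B) hc
    simpa [LinearMap.aeval_self_charpoly] using this
  rcases subsingleton_or_nontrivial (Module.End K V) with _ | _
  · exact ⟨1, one_pos, Subsingleton.elim _ _⟩
  have : CharP (Module.End K V) p :=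
    charP_of_injective_algebraMap (algebraMap K (Module.End K V)).injective p
  have hp : 0 < p := (Fact.out : p.Prime).pos
  refine ⟨N * p ^ Module.finrank K V, mul_pos hN (pow_pos hp _), ?_⟩
  have h1 := sub_pow_char_pow_of_commute (p := p) (n := Module.finrank K V)
    (Commute.one_right (B ^ N))
  rw [pow_eq_zero_of_le (Nat.lt_pow_self (Fact.out : p.Prime).one_lt).le h0, one_pow] at h1
  rw [pow_mul]
  exact (sub_eq_zero.1 h1.symm)

theorem FreeGroup.not_injective_of_roots_charpoly {K V : Type*} [Field K] [IsAlgClosed K]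
    [AddCommGroup V] [Module K V] [FiniteDimensional K V]
    (r : FreeGroup (Fin 2) →* Module.End K V)
    (hr : ∀ w, ∀ b ∈ (r w).charpoly.roots, ∃ N > 0, b ^ N = 1) :
    ¬ Function.Injective r := by
  obtain _ | ⟨p, _, _⟩ := CharP.exists' K
  · exact not_injective_of_finite_range_trace r (finite_range_trace r hr)
  · intro hinj
    obtain ⟨N, hN, h⟩ := Module.End.exists_pow_eq_one_of_charP p _ (hr (of 0))
    have h1 : (of 0 : FreeGroup (Fin 2)) ^ N = 1 := hinj (by rw [map_pow, h, _root_.map_one])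
    rw [pow_eq_one_iff_left hN.ne'] at h1
    exact of_ne_one 0 h1

/-- An element of a free group commuting with two distinct generators is trivial. -/
theorem FreeGroup.eq_one_of_commute_of {α : Type*} [DecidableEq α] {a b : α} (hab : a ≠ b)
    {w : FreeGroup α} (ha : Commute w (of a)) (hb : Commute w (of b)) : w = 1 := by
  by_contra hw
  have hne : w.toWord ≠ [] := fun h => hw (toWord_eq_nil_iff.1 h)
  obtain ⟨⟨c, e⟩, l, hl⟩ := List.exists_cons_of_ne_nil hne
  obtain ⟨s, hs, hcomm⟩ : ∃ s, s ≠ c ∧ Commute w (of s) := by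
    by_cases h : a = c
    · exact ⟨b, fun h' => hab (h.trans h'.symm), hb⟩
    · exact ⟨a, h, ha⟩
  have hleft : (of s * w).toWord = (s, true) :: w.toWord := by
    rw [toWord_mul, toWord_of, List.singleton_append, reduce.cons, reduce_toWord, hl]
    simp [hs]
  have hsub := toWord_mul_sublist w (of s)
  rw [hcomm.eq, hleft, toWord_of] at hsub
  have := hsub.eq_of_length (by simp)
  rw [hl, List.cons_append, List.cons.injEq, Prod.mk.injEq] at this
  exact hs this.1.1

/-- The permutation of `ℤ × K` by left multiplication by `f i` on the fibre over `i`. -/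
def fiberMul {K : Type*} [Group K] (f : ℤ → K) : Equiv.Perm (ℤ × K) where
  toFun p := (p.1, f p.1 * p.2)
  invFun p := (p.1, (f p.1)⁻¹ * p.2)
  left_inv p := by simp
  right_inv p := by simp

/-- The permutation of `ℤ × K` shifting the base by `-1`. -/
def baseShift (K : Type*) : Equiv.Perm (ℤ × K) where
  toFun p := (p.1 - 1, p.2)
  invFun p := (p.1 + 1, p.2)
  left_inv p := by simp
  right_inv p := by simp

/-- The commutators `[x, y]` and `x² [x, y] x⁻²`. -/
def commWord {H : Type*} [Group H] (x y : H) : Fin 2 → H :=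
  ![⁅x, y⁆, x ^ 2 * ⁅x, y⁆ * (x ^ 2)⁻¹]

theorem commWord_mem_commutator {H : Type*} [Group H] (x y : H) (i : Fin 2) :
    commWord x y i ∈ commutator H := by
  have h : ⁅x, y⁆ ∈ commutator H :=
    Subgroup.commutator_mem_commutator (Subgroup.mem_top _) (Subgroup.mem_top _)
  fin_cases i
  · exact h
  · exact Subgroup.Normal.conj_mem inferInstance _ h _

/-- The two commutators `commWord x₀ x₁` together with the generator `x₂`. -/
def commBasis : Fin 3 → FreeGroup (Fin 3) :=
  ![commWord (.of 0) (.of 1) 0, commWord (.of 0) (.of 1) 1, .of 2]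

theorem lift_commBasis_injective : Function.Injective (FreeGroup.lift commBasis) := by
  let θ : FreeGroup (Fin 3) →* Equiv.Perm (ℤ × FreeGroup (Fin 3)) :=
    FreeGroup.lift ![baseShift _,
      fiberMul (fun i => if i = 1 then .of 0 else if i = 3 then .of 1 else 1),
      fiberMul (fun _ => .of 2)]
  have key : ∀ u k, θ (FreeGroup.lift commBasis u) (0, k) = (0, u * k) := by
    intro u
    induction u using FreeGroup.induction_on with
    | C1 => simp
    | of i =>
      intro k
      fin_cases i <;>
      simp [θ, commBasis, commWord, commutatorElement_def, pow_two, baseShift, fiberMul,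
        Equiv.Perm.mul_apply, Equiv.Perm.inv_def]
    | inv_of i ih =>
      intro k
      rw [map_inv, map_inv, Equiv.Perm.inv_eq_iff_eq, ih]
      simp
    | mul u v hu hv =>
      intro k
      rw [map_mul, map_mul, Equiv.Perm.mul_apply, hv, hu, mul_assoc]
  intro u v h
  have := key u 1
  rw [h, key v 1] at this
  simpa using this.symm

theorem lift_commWord_mem_commutator {H : Type*} [Group H] (x y : H) (w : FreeGroup (Fin 2)) :
    FreeGroup.lift (commWord x y) w ∈ commutator H := by
  have : (FreeGroup.lift (commWord x y)).range ≤ commutator H := by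
    rw [FreeGroup.range_lift_eq_closure, Subgroup.closure_le]
    rintro _ ⟨i, rfl⟩
    exact commWord_mem_commutator x y i
  exact this ⟨w, rfl⟩

theorem lift_commWord_injective :
    Function.Injective (FreeGroup.lift (commWord (.of 0 : FreeGroup (Fin 3)) (.of 1))) := by
  have h : (FreeGroup.lift commBasis).comp (FreeGroup.map ![0, 1]) =
      FreeGroup.lift (commWord (.of 0) (.of 1)) := by
    ext i
    fin_cases i <;> simp [commBasis]
  rw [← h, MonoidHom.coe_comp]
  exact lift_commBasis_injective.comp (FreeGroup.map_injective (by decide))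

/-- The endomorphism of `F₃` fixing `x₀, x₁` and sending `x₂` to `x₂ v`, for `v` in the
subgroup of commutators of `F(x₀, x₁)` generated by `commWord x₀ x₁`. -/
def transvectionHom (w : FreeGroup (Fin 2)) : FreeGroup (Fin 3) →* FreeGroup (Fin 3) :=
  FreeGroup.lift ![.of 0, .of 1, .of 2 * FreeGroup.lift (commWord (.of 0) (.of 1)) w]

theorem transvectionHom_lift_commWord (w v : FreeGroup (Fin 2)) :
    transvectionHom w (FreeGroup.lift (commWord (.of 0) (.of 1)) v) =
      FreeGroup.lift (commWord (.of 0) (.of 1)) v := by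
  suffices h : (transvectionHom w).comp (FreeGroup.lift (commWord (.of 0) (.of 1))) =
      FreeGroup.lift (commWord (.of 0) (.of 1)) from DFunLike.congr_fun h v
  ext i
  fin_cases i <;> simp [commWord, transvectionHom, commutatorElement_def]

theorem transvectionHom_mul (w v : FreeGroup (Fin 2)) :
    (transvectionHom w).comp (transvectionHom v) = transvectionHom (w * v) := by
  ext i
  fin_cases i
  · simp [transvectionHom]
  · simp [transvectionHom]
  · change transvectionHom w (transvectionHom v (.of 2)) = transvectionHom (w * v) (.of 2)
    have h : ∀ u, transvectionHom u (.of 2) =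
      .of 2 * FreeGroup.lift (commWord (.of 0) (.of 1)) u := fun u => by simp [transvectionHom]
    rw [h v, map_mul, h, transvectionHom_lift_commWord, h, map_mul, mul_assoc]

theorem transvectionHom_one : transvectionHom 1 = MonoidHom.id _ := by
  ext i
  fin_cases i <;> simp [transvectionHom]

/-- `transvectionHom` as a family of automorphisms. -/
def transvection : FreeGroup (Fin 2) →* MulAut (FreeGroup (Fin 3)) where
  toFun w := MonoidHom.toMulEquiv (transvectionHom w) (transvectionHom w⁻¹)
    (by rw [transvectionHom_mul, inv_mul_cancel, transvectionHom_one])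
    (by rw [transvectionHom_mul, mul_inv_cancel, transvectionHom_one])
  map_one' := by
    ext x : 1
    exact DFunLike.congr_fun transvectionHom_one x
  map_mul' w v := by
    ext x : 1
    exact (DFunLike.congr_fun (transvectionHom_mul w v) x).symm

theorem transvection_mem_IA (w : FreeGroup (Fin 2)) : transvection w ∈ IA 3 := by
  suffices h : (Abelianization.of.comp (transvectionHom w)) = Abelianization.of from
    fun x => DFunLike.congr_fun h x
  ext i
  have hw : Abelianization.of (FreeGroup.lift (commWord (.of 0) (.of 1)) w) =
      (1 : Abelianization (FreeGroup (Fin 3))) := by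
    rw [← MonoidHom.mem_ker, Abelianization.ker_of]
    exact lift_commWord_mem_commutator _ _ w
  fin_cases i <;> simp [transvectionHom, hw]

theorem conj_mem_IA {n : ℕ} (u : FreeGroup (Fin n)) : MulAut.conj u ∈ IA n := by
  intro x
  simp [MulAut.conj_apply]

/-- Transvections as elements of `IA(F₃)`. -/
def transvectionIA : FreeGroup (Fin 2) →* IA 3 :=
  transvection.codRestrict _ transvection_mem_IA

/-- Inner automorphisms as elements of `IA(Fₙ)`. -/
def conjIA (n : ℕ) : FreeGroup (Fin n) →* IA n :=
  MulAut.conj.codRestrict _ conj_mem_IA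

theorem transvectionIA_mul_conjIA (w : FreeGroup (Fin 2)) (u : FreeGroup (Fin 3)) :
    transvectionIA w * conjIA 3 u = conjIA 3 (transvectionHom w u) * transvectionIA w := by
  apply Subtype.ext
  ext x : 1
  change transvectionHom w (u * x * u⁻¹) =
    transvectionHom w u * transvectionHom w x * (transvectionHom w u)⁻¹
  simp

theorem conjIA_mul_transvectionIA_commute (w v : FreeGroup (Fin 2)) :
    Commute (transvectionIA w)
      ((conjIA 3).comp (FreeGroup.lift (commWord (.of 0) (.of 1))) v) := by
  change _ * conjIA 3 _ = conjIA 3 _ * _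
  rw [transvectionIA_mul_conjIA, transvectionHom_lift_commWord]

/-- The embedding of the poison group into `IA(F₃)`: the first factor acts by transvections, the
second by conjugation, and the stable letter is conjugation by `x₂`. -/
def poisonToIA : PoisonGroup →* IA 3 :=
  HNNExtension.lift
    (transvectionIA.noncommCoprod ((conjIA 3).comp (FreeGroup.lift (commWord (.of 0) (.of 1))))
      conjIA_mul_transvectionIA_commute)
    (conjIA 3 (.of 2)) (by
      rintro ⟨⟨w, v⟩, h : w = v⟩
      subst h
      change conjIA 3 (.of 2) * (transvectionIA w * conjIA 3 _) =
        (transvectionIA w * (conjIA 3).comp _ 1) * conjIA 3 (.of 2)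
      rw [map_one, mul_one, transvectionIA_mul_conjIA, transvectionIA_mul_conjIA,
        transvectionHom_lift_commWord, ← mul_assoc, ← map_mul]
      simp [transvectionHom])

/-- The vertex group `G × G` of the Formanek–Procesi group. -/
def FPGroup.of {G : Type*} [Group G] : G × G →* FPGroup G := HNNExtension.of

/-- The stable letter of the Formanek–Procesi group. -/
def FPGroup.t {G : Type*} [Group G] : FPGroup G := HNNExtension.t

theorem FPGroup.t_mul_of {G : Type*} [Group G] (g : G) :
    (t : FPGroup G) * of (g, g) = of (g, 1) * t :=
  HNNExtension.t_mul_of (⟨(g, g), rfl⟩ : diagSubgroup G)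

theorem FPGroup.of_injective {G : Type*} [Group G] :
    Function.Injective (of : G × G →* FPGroup G) := HNNExtension.of_injective _

/-- Induction principle for the Formanek–Procesi group. -/
theorem FPGroup.induction_on {G : Type*} [Group G] {motive : FPGroup G → Prop} (x : FPGroup G)
    (of : ∀ g, motive (FPGroup.of g)) (t : motive FPGroup.t)
    (mul : ∀ x y, motive x → motive y → motive (x * y))
    (inv : ∀ x, motive x → motive x⁻¹) : motive x :=
  HNNExtension.induction_on x of t mul inv

/-- The normal subgroup of the poison group which is free on the second factor and the stable
letter. -/
def poisonFree : FreeGroup (Fin 3) →* PoisonGroup :=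
  FreeGroup.lift ![FPGroup.of (1, .of 0), FPGroup.of (1, .of 1), FPGroup.t]

theorem poisonFree_map (w : FreeGroup (Fin 2)) :
    poisonFree (FreeGroup.map ![0, 1] w) = FPGroup.of (1, w) := by
  suffices h : poisonFree.comp (FreeGroup.map ![0, 1]) =
      FPGroup.of.comp (MonoidHom.inr _ _) from DFunLike.congr_fun h w
  ext i
  fin_cases i <;> simp [poisonFree]

theorem of_mul_t_mul_of_inv (w : FreeGroup (Fin 2)) :
    (FPGroup.of (w, 1) * FPGroup.t * FPGroup.of (w, 1)⁻¹ : PoisonGroup) =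
      FPGroup.t * FPGroup.of (1, w) := by
  rw [← FPGroup.t_mul_of, mul_assoc, ← map_mul]
  simp

theorem exists_of_mul_poisonFree (w : FreeGroup (Fin 2)) (u : FreeGroup (Fin 3)) :
    ∃ u', FPGroup.of (w, 1) * poisonFree u = poisonFree u' * FPGroup.of (w, 1) := by
  suffices h : (MulAut.conj (FPGroup.of (w, 1))).toMonoidHom.comp poisonFree =
      poisonFree.comp (FreeGroup.lift
        ![.of 0, .of 1, .of 2 * FreeGroup.map ![0, 1] w]) from
    ⟨_, mul_inv_eq_iff_eq_mul.1 (DFunLike.congr_fun h u)⟩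
  ext i
  have hcomm : ∀ v : FreeGroup (Fin 2),
      (FPGroup.of (w, 1) * FPGroup.of (1, v) * (FPGroup.of (w, 1))⁻¹ : PoisonGroup) =
        FPGroup.of (1, v) := fun v => by
    rw [← map_inv, ← map_mul, ← map_mul]
    simp
  fin_cases i
  · simpa [poisonFree] using hcomm _
  · simpa [poisonFree] using hcomm _
  · change FPGroup.of (w, 1) * poisonFree (.of 2) * (FPGroup.of (w, 1))⁻¹ =
      poisonFree (FreeGroup.lift _ (.of 2))
    rw [FreeGroup.lift_apply_of]
    simp only [Matrix.cons_val]
    rw [map_mul, poisonFree_map]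
    have h2 : poisonFree (.of 2) = FPGroup.t := by simp [poisonFree]
    rw [h2, ← map_inv, of_mul_t_mul_of_inv]

theorem exists_eq_poisonFree_mul (h : PoisonGroup) :
    ∃ u w, h = poisonFree u * FPGroup.of (w, 1) := by
  induction h using FPGroup.induction_on with
  | of g =>
    obtain ⟨w, v⟩ := g
    refine ⟨FreeGroup.map ![0, 1] v, w, ?_⟩
    rw [poisonFree_map, ← map_mul]
    simp
  | t =>
    refine ⟨.of 2, 1, ?_⟩
    rw [← Prod.one_eq_mk, map_one, mul_one]
    simp [poisonFree]
  | mul x y hx hy =>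
    obtain ⟨u, w, rfl⟩ := hx
    obtain ⟨u', w', rfl⟩ := hy
    obtain ⟨u'', h⟩ := exists_of_mul_poisonFree w u'
    refine ⟨u * u'', w * w', ?_⟩
    have : (FPGroup.of (w * w', 1) : PoisonGroup) = FPGroup.of (w, 1) * FPGroup.of (w', 1) := by
      rw [← map_mul]; simp
    rw [this, map_mul, mul_assoc, ← mul_assoc (FPGroup.of (w, 1)), h]
    simp only [mul_assoc]
  | inv x hx =>
    obtain ⟨u, w, rfl⟩ := hx
    obtain ⟨u', h⟩ := exists_of_mul_poisonFree w⁻¹ u⁻¹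
    refine ⟨u', w⁻¹, ?_⟩
    rw [← h, mul_inv_rev, ← map_inv, ← map_inv]
    simp

theorem poisonToIA_of (w v : FreeGroup (Fin 2)) :
    poisonToIA (FPGroup.of (w, v)) =
      transvectionIA w * conjIA 3 (FreeGroup.lift (commWord (.of 0) (.of 1)) v) :=
  HNNExtension.lift_of _ _ _ _

theorem poisonToIA_t : poisonToIA FPGroup.t = conjIA 3 (.of 2) :=
  HNNExtension.lift_t _ _ _

theorem poisonToIA_poisonFree (u : FreeGroup (Fin 3)) :
    poisonToIA (poisonFree u) = conjIA 3 (FreeGroup.lift commBasis u) := by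
  suffices h : poisonToIA.comp poisonFree = (conjIA 3).comp (FreeGroup.lift commBasis) from
    DFunLike.congr_fun h u
  ext i : 1
  fin_cases i <;> simp [poisonFree, commBasis, poisonToIA_of, poisonToIA_t]

theorem poisonToIA_injective : Function.Injective poisonToIA := by
  rw [injective_iff_map_eq_one]
  intro h hh
  obtain ⟨u, w, rfl⟩ := exists_eq_poisonFree_mul h
  rw [map_mul, poisonToIA_poisonFree, poisonToIA_of, map_one,
    map_one, mul_one] at hh
  set c := FreeGroup.lift commBasis u
  have key : ∀ x, c * transvectionHom w x * c⁻¹ = x := fun x =>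
    DFunLike.congr_fun (congrArg Subtype.val hh) x
  have h0 := key (.of 0)
  have h1 := key (.of 1)
  have h2 := key (.of 2)
  simp only [transvectionHom, FreeGroup.lift_apply_of, Matrix.cons_val] at h0 h1 h2
  have hc : c = 1 := FreeGroup.eq_one_of_commute_of (a := 0) (b := 1) (by decide)
    (mul_inv_eq_iff_eq_mul.1 h0) (mul_inv_eq_iff_eq_mul.1 h1)
  have hu : u = 1 := lift_commBasis_injective (by simpa using hc)
  have hw : w = 1 := lift_commWord_injective (by simpa [hc] using h2)
  subst hu hw
  rw [map_one, one_mul]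
  exact map_one FPGroup.of

theorem exists_subgroup_IA_mulEquiv_poisonGroup :
    ∃ S : Subgroup (IA 3), Nonempty (S ≃* PoisonGroup) :=
  ⟨poisonToIA.range, ⟨(MonoidHom.ofInjective poisonToIA_injective).symm⟩⟩

theorem not_injective_poisonGroup_toEnd {K V : Type*} [Field K] [IsAlgClosed K]
    [AddCommGroup V] [Module K V] [FiniteDimensional K V]
    (ρ : PoisonGroup →* Module.End K V) : ¬ Function.Injective ρ := by
  intro hρ
  let s : FreeGroup (Fin 2) →* Module.End K V :=
    ρ.comp (FPGroup.of.comp (MonoidHom.inr _ _))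
  let c : FreeGroup (Fin 2) →* FreeGroup (Fin 2) := FreeGroup.lift (commWord (.of 0) (.of 1))
  have hc : Function.Injective c := by
    have h : (FreeGroup.map ![(0 : Fin 3), 1]).comp c =
        FreeGroup.lift (commWord (.of 0) (.of 1)) := by
      ext i : 1
      fin_cases i <;> simp [c, commWord]
    refine Function.Injective.of_comp (f := FreeGroup.map ![(0 : Fin 3), 1]) ?_
    rw [← MonoidHom.coe_comp, h]
    exact lift_commWord_injective
  have hs : Function.Injective s :=
    hρ.comp (FPGroup.of_injective.comp fun x y h => (Prod.ext_iff.1 h).2)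
  refine FreeGroup.not_injective_of_roots_charpoly (s.comp c) (fun w b hb => ?_) (hs.comp hc)
  let A : Module.End K V := ρ (FPGroup.of (c w, 1))
  have hunit (x : PoisonGroup) : IsUnit (ρ x) := (Group.isUnit x).map ρ
  have hA : Function.Injective A := ((Module.End.isUnit_iff _).1 (hunit _)).injective
  refine Module.End.exists_pow_eq_one_of_mem_commutator s hA (fun g => ?_)
    (lift_commWord_mem_commutator _ _ w) ?_ hb
  · change ρ _ * ρ _ = ρ _ * ρ _
    rw [← map_mul, ← map_mul]
    simp [← map_mul]
  · have h : ρ FPGroup.t * (A * s (c w)) = A * ρ FPGroup.t := by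
      have := congrArg ρ (FPGroup.t_mul_of (c w))
      simpa [A, s, ← map_mul] using this
    let e := LinearEquiv.ofBijective (ρ FPGroup.t) ((Module.End.isUnit_iff _).1 (hunit _))
    rw [← LinearEquiv.charpoly_conj e (A * s (c w))]
    congr 1
    ext v
    obtain ⟨v, rfl⟩ := e.surjective v
    rw [LinearEquiv.conj_apply_apply, e.symm_apply_apply]
    exact DFunLike.congr_fun h v

theorem not_isLinear_of_injective {L : Type*} [Group L] {f : PoisonGroup →* L}
    (hf : Function.Injective f) : ¬ IsLinear L := by
  rintro ⟨K, _, n, g, hg⟩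
  let E := AlgebraicClosure K
  let e : Matrix (Fin n) (Fin n) E ≃ₐ[E] Module.End E (Fin n → E) := Matrix.toLinAlgEquiv'
  let ρ : GL (Fin n) K →* Module.End E (Fin n → E) :=
    (e : Matrix (Fin n) (Fin n) E →* _).comp
      ((algebraMap K E).mapMatrix.toMonoidHom.comp (Units.coeHom _))
  have hρ : Function.Injective ρ :=
    e.injective.comp ((Matrix.map_injective (algebraMap K E).injective).comp Units.val_injective)
  exact not_injective_poisonGroup_toEnd (ρ.comp (g.comp f)) (hρ.comp (hg.comp hf))

/-- `IA(F₃)` contains a copy of the poison group `H(F₂)`; hence it is not linear. -/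
theorem IA_three_contains_poison_and_not_linear :
    (∃ S : Subgroup (IA 3), Nonempty (S ≃* PoisonGroup)) ∧ ¬ IsLinear (IA 3) :=
  ⟨exists_subgroup_IA_mulEquiv_poisonGroup, not_isLinear_of_injective poisonToIA_injective⟩
end

section
/- The group H presented by generators x₁, x₂, x₃, x₄, x₅ with relations [x₁,x₃] = [x₂,x₄] = [x₁^{x₅}, x₃] = [x₂^{x₅}, x₄] = 1 and [x₁x₃, x₂] = [x₂x₄, x₁] = [x₁^{x₅}x₃, x₄] = [x₂^{x₅}x₄, x₃] = 1 is isomorphic to a normal subgroup of index 2 in the poison group H(F₂), and H is not linear. -/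
/-!
STATEMENT 13: The group `H` presented by generators `x₁,…,x₅` and relations
`[x₁,x₃] = [x₂,x₄] = [x₁^{x₅},x₃] = [x₂^{x₅},x₄] = 1`,
`[x₁x₃,x₂] = [x₂x₄,x₁] = [x₁^{x₅}x₃,x₄] = [x₂^{x₅}x₄,x₃] = 1`
(where `[a,b] = a⁻¹b⁻¹ab`, `a^b = b⁻¹ab`) is isomorphic to a normal subgroup of
index 2 in the poison group `H(F₂)`, and `H` is not linear.
-/
variable (G : Type*) [Group G]

/-- The commutator convention of the paper: `[a,b] = a⁻¹ b⁻¹ a b`. -/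
def pcomm {α : Type*} [Group α] (a b : α) : α := a⁻¹ * b⁻¹ * a * b

/-- Conjugation convention: `a^b = b⁻¹ a b`. -/
def pconj {α : Type*} [Group α] (a b : α) : α := b⁻¹ * a * b

/-- The generators `x₁, …, x₅`. -/
noncomputable abbrev xg (i : Fin 5) : FreeGroup (Fin 5) := FreeGroup.of i

/-- The eight relators of the presentation of `H`. -/
noncomputable def relsH5 : Set (FreeGroup (Fin 5)) :=
  { pcomm (xg 0) (xg 2),
    pcomm (xg 1) (xg 3),
    pcomm (pconj (xg 0) (xg 4)) (xg 2),
    pcomm (pconj (xg 1) (xg 4)) (xg 3),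
    pcomm (xg 0 * xg 2) (xg 1),
    pcomm (xg 1 * xg 3) (xg 0),
    pcomm (pconj (xg 0) (xg 4) * xg 2) (xg 3),
    pcomm (pconj (xg 1) (xg 4) * xg 3) (xg 2) }

/-- The presented group `H`. -/
noncomputable abbrev H5 := PresentedGroup relsH5

section PoisonStructure

/-- The inclusion of `F₂ × F₂` in the poison group. -/
def poisonOf : FreeGroup (Fin 2) × FreeGroup (Fin 2) →* PoisonGroup :=
  (HNNExtension.of : _ →* HNNExtension _ _ _ (diagToLeft (FreeGroup (Fin 2))))

/-- The stable letter of the poison group. -/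
def poisonT : PoisonGroup :=
  (HNNExtension.t : HNNExtension _ _ _ (diagToLeft (FreeGroup (Fin 2))))

theorem poisonOf_injective : Function.Injective poisonOf :=
  HNNExtension.of_injective (diagToLeft (FreeGroup (Fin 2)))

theorem poisonT_mul_of_diag (g : FreeGroup (Fin 2)) :
    poisonT * poisonOf (g, g) = poisonOf (g, 1) * poisonT :=
  HNNExtension.t_mul_of (φ := diagToLeft (FreeGroup (Fin 2))) ⟨(g, g), rfl⟩

/-- The universal property of the poison group. -/
def poisonLift {M : Type*} [Group M] (f : FreeGroup (Fin 2) × FreeGroup (Fin 2) →* M) (x : M)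
    (hx : ∀ g, x * f (g, g) = f (g, 1) * x) : PoisonGroup →* M :=
  HNNExtension.lift (φ := diagToLeft (FreeGroup (Fin 2))) f x (by
    rintro ⟨⟨a, b⟩, (h : a = b)⟩
    subst h
    exact hx a)

@[simp]
theorem poisonLift_of {M : Type*} [Group M] (f : FreeGroup (Fin 2) × FreeGroup (Fin 2) →* M)
    (x : M) (hx : ∀ g, x * f (g, g) = f (g, 1) * x) (p : FreeGroup (Fin 2) × FreeGroup (Fin 2)) :
    poisonLift f x hx (poisonOf p) = f p :=
  HNNExtension.lift_of _ _ _ _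

@[simp]
theorem poisonLift_t {M : Type*} [Group M] (f : FreeGroup (Fin 2) × FreeGroup (Fin 2) →* M)
    (x : M) (hx : ∀ g, x * f (g, g) = f (g, 1) * x) :
    poisonLift f x hx poisonT = x :=
  HNNExtension.lift_t _ _ _

theorem poison_induction {motive : PoisonGroup → Prop} (x : PoisonGroup)
    (of : ∀ p, motive (poisonOf p)) (t : motive poisonT)
    (mul : ∀ x y, motive x → motive y → motive (x * y))
    (inv : ∀ x, motive x → motive x⁻¹) : motive x :=
  HNNExtension.induction_on (φ := diagToLeft (FreeGroup (Fin 2))) x of t mul inv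

/-- The generators of the presented group. -/
noncomputable def h5Gen (i : Fin 5) : H5 := PresentedGroup.of i

theorem commute_of_pcomm_eq_one {α : Type*} [Group α] {a b : α} (h : pcomm a b = 1) :
    Commute a b := by
  unfold pcomm at h
  have h1 : a * b = b * a * (a⁻¹ * b⁻¹ * a * b) := by group
  rwa [h, mul_one] at h1

theorem pcomm_eq_one_of_commute {α : Type*} [Group α] {a b : α} (h : Commute a b) :
    pcomm a b = 1 := by
  unfold pcomm
  rw [mul_assoc, h.eq]
  group

theorem map_pcomm {α β : Type*} [Group α] [Group β] (f : α →* β) (a b : α) :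
    f (pcomm a b) = pcomm (f a) (f b) := by
  simp [pcomm]

theorem map_pconj {α β : Type*} [Group α] [Group β] (f : α →* β) (a b : α) :
    f (pconj a b) = pconj (f a) (f b) := by
  simp [pconj]

theorem h5_commute {a b : FreeGroup (Fin 5)} (h : pcomm a b ∈ relsH5) :
    Commute (PresentedGroup.mk relsH5 a) (PresentedGroup.mk relsH5 b) := by
  apply commute_of_pcomm_eq_one
  rw [← map_pcomm]
  exact PresentedGroup.one_of_mem h

theorem commute_freeGroupLift {α β G : Type*} [Group G] {f : α → G} {f' : β → G}
    (h : ∀ i j, Commute (f i) (f' j)) (x : FreeGroup α) (y : FreeGroup β) :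
    Commute (FreeGroup.lift f x) (FreeGroup.lift f' y) := by
  have key : ∀ (c : G), (∀ i, Commute (f i) c) → Commute (FreeGroup.lift f x) c := by
    intro c hc
    induction x using FreeGroup.induction_on with
    | C1 => simp
    | of i => simpa using hc i
    | inv_of i hi => rw [map_inv]; exact hi.inv_left
    | mul x y hx hy => rw [map_mul]; exact hx.mul_left hy
  refine key _ fun i => ?_
  induction y using FreeGroup.induction_on with
  | C1 => simp
  | of j => simpa using h i j
  | inv_of j hj => rw [map_inv]; exact hj.inv_right
  | mul x y hx hy => rw [map_mul]; exact hx.mul_right hy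

theorem h5Gen_commute_zero_two : Commute (h5Gen 0) (h5Gen 2) :=
  h5_commute (a := xg 0) (b := xg 2) (by simp [relsH5])

theorem h5Gen_commute_one_three : Commute (h5Gen 1) (h5Gen 3) :=
  h5_commute (a := xg 1) (b := xg 3) (by simp [relsH5])

theorem h5Gen_commute_pconj_zero_two : Commute (pconj (h5Gen 0) (h5Gen 4)) (h5Gen 2) :=
  h5_commute (a := pconj (xg 0) (xg 4)) (b := xg 2) (by simp [relsH5])

theorem h5Gen_commute_pconj_one_three : Commute (pconj (h5Gen 1) (h5Gen 4)) (h5Gen 3) :=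
  h5_commute (a := pconj (xg 1) (xg 4)) (b := xg 3) (by simp [relsH5])

/-- The homomorphism `F₂ × F₂ → H` whose image corresponds to the vertex group of the poison
group. -/
noncomputable def h5Vertex : FreeGroup (Fin 2) × FreeGroup (Fin 2) →* H5 :=
  MonoidHom.noncommCoprod
    (FreeGroup.lift ![(h5Gen 2)⁻¹, (h5Gen 3)⁻¹])
    (FreeGroup.lift ![pconj (h5Gen 0) (h5Gen 4) * h5Gen 2, pconj (h5Gen 1) (h5Gen 4) * h5Gen 3])
    (commute_freeGroupLift (by
      have h03 : Commute (pconj (h5Gen 0) (h5Gen 4) * h5Gen 2) (h5Gen 3) :=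
        h5_commute (a := pconj (xg 0) (xg 4) * xg 2) (b := xg 3) (by simp [relsH5])
      have h12 : Commute (pconj (h5Gen 1) (h5Gen 4) * h5Gen 3) (h5Gen 2) :=
        h5_commute (a := pconj (xg 1) (xg 4) * xg 3) (b := xg 2) (by simp [relsH5])
      intro i j
      fin_cases i <;> fin_cases j <;>
        simp only [Fin.zero_eta, Fin.mk_one, Matrix.cons_val_zero, Matrix.cons_val_one] <;>
        apply Commute.inv_left
      · exact (h5Gen_commute_pconj_zero_two.mul_left (Commute.refl _)).symm
      · exact h12.symm
      · exact h03.symm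
      · exact (h5Gen_commute_pconj_one_three.mul_left (Commute.refl _)).symm))

/-- The homomorphism `F₂ × F₂ → H` whose image corresponds to the conjugate by the stable letter of
the vertex group of the poison group. -/
noncomputable def h5ConjVertex : FreeGroup (Fin 2) × FreeGroup (Fin 2) →* H5 :=
  MonoidHom.noncommCoprod
    (FreeGroup.lift ![h5Gen 0, h5Gen 1])
    (FreeGroup.lift ![(h5Gen 0 * h5Gen 2)⁻¹, (h5Gen 1 * h5Gen 3)⁻¹])
    (commute_freeGroupLift (by
      have h01 : Commute (h5Gen 0 * h5Gen 2) (h5Gen 1) :=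
        h5_commute (a := xg 0 * xg 2) (b := xg 1) (by simp [relsH5])
      have h10 : Commute (h5Gen 1 * h5Gen 3) (h5Gen 0) :=
        h5_commute (a := xg 1 * xg 3) (b := xg 0) (by simp [relsH5])
      intro i j
      fin_cases i <;> fin_cases j <;>
        simp only [Fin.zero_eta, Fin.mk_one, Matrix.cons_val_zero, Matrix.cons_val_one] <;>
        apply Commute.inv_right
      · exact (Commute.refl _).mul_right h5Gen_commute_zero_two
      · exact h10.symm
      · exact h01.symm
      · exact (Commute.refl _).mul_right h5Gen_commute_one_three))

theorem h5ConjVertex_diag (g : FreeGroup (Fin 2)) :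
    h5ConjVertex (g, g) = h5Vertex (g, 1) := by
  have key : h5ConjVertex.comp ((MonoidHom.id _).prod (MonoidHom.id _)) =
      h5Vertex.comp ((MonoidHom.id _).prod 1) := by
    apply FreeGroup.ext_hom
    intro i
    fin_cases i <;>
      simp [h5ConjVertex, h5Vertex, h5Gen_commute_zero_two.eq, h5Gen_commute_one_three.eq]
  exact DFunLike.congr_fun key g

theorem h5Gen_mul_vertex_diag (g : FreeGroup (Fin 2)) :
    h5Gen 4 * h5Vertex (g, g) = h5ConjVertex (g, 1) * h5Gen 4 := by
  have key : (MulAut.conj (h5Gen 4)).toMonoidHom.comp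
      (h5Vertex.comp ((MonoidHom.id _).prod (MonoidHom.id _))) =
      h5ConjVertex.comp ((MonoidHom.id _).prod 1) := by
    apply FreeGroup.ext_hom
    intro i
    fin_cases i <;>
      simp [h5ConjVertex, h5Vertex, h5Gen_commute_pconj_zero_two.eq,
        h5Gen_commute_pconj_one_three.eq] <;>
      simp [pconj, mul_assoc]
  have h := DFunLike.congr_fun key g
  simp only [MonoidHom.comp_apply, MonoidHom.prod_apply, MonoidHom.id_apply,
    MulEquiv.coe_toMonoidHom, MulAut.conj_apply, MonoidHom.one_apply] at h
  rw [← h, inv_mul_cancel_right]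

section Induced

variable {R : Type*} [Ring R] (ψ : H5 →* R)

/-- The diagonal matrix with entries the images of the two vertex homomorphisms. -/
noncomputable def inducedVertex :
    FreeGroup (Fin 2) × FreeGroup (Fin 2) →* (Matrix (Fin 2) (Fin 2) R)ˣ :=
  MonoidHom.toHomUnits
    { toFun := fun p => !![ψ (h5Vertex p), 0; 0, ψ (h5ConjVertex p)]
      map_one' := by simp [Matrix.one_fin_two]
      map_mul' := by intro p q; simp }

/-- The image of the stable letter under the induced representation. -/
noncomputable def inducedT : (Matrix (Fin 2) (Fin 2) R)ˣ where
  val := !![0, 1; ψ (h5Gen 4), 0]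
  inv := !![0, ψ (h5Gen 4)⁻¹; 1, 0]
  val_inv := by simp [Matrix.one_fin_two, ← map_mul]
  inv_val := by simp [Matrix.one_fin_two, ← map_mul]

/-- The representation of the poison group induced from a representation of `H`. -/
noncomputable def induced : PoisonGroup →* (Matrix (Fin 2) (Fin 2) R)ˣ :=
  poisonLift (inducedVertex ψ) (inducedT ψ) (by
    intro g
    ext1
    simp [inducedVertex, inducedT, h5ConjVertex_diag, ← map_mul, h5Gen_mul_vertex_diag])

theorem induced_of_val (p : FreeGroup (Fin 2) × FreeGroup (Fin 2)) :
    (induced ψ (poisonOf p)).val = !![ψ (h5Vertex p), 0; 0, ψ (h5ConjVertex p)] := by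
  simp [induced, inducedVertex]

theorem induced_of_inv_val (p : FreeGroup (Fin 2) × FreeGroup (Fin 2)) :
    (induced ψ (poisonOf p))⁻¹.val = !![ψ (h5Vertex p⁻¹), 0; 0, ψ (h5ConjVertex p⁻¹)] := by
  rw [← map_inv, ← map_inv, induced_of_val]

theorem induced_t_val : (induced ψ poisonT).val = !![0, 1; ψ (h5Gen 4), 0] := by
  simp [induced, inducedT]

theorem induced_t_inv_val :
    (induced ψ poisonT)⁻¹.val = !![0, ψ (h5Gen 4)⁻¹; 1, 0] := by
  simp [induced, inducedT]

end Induced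

theorem commute_poisonOf (g h : FreeGroup (Fin 2)) :
    Commute (poisonOf (g, 1)) (poisonOf (1, h)) := by
  simp [Commute, SemiconjBy, ← map_mul]

/-- The images in the poison group of the generators of `H`. -/
def poisonGen : Fin 5 → PoisonGroup :=
  ![poisonT * poisonOf (FreeGroup.of 0, 1) * poisonT⁻¹,
    poisonT * poisonOf (FreeGroup.of 1, 1) * poisonT⁻¹,
    (poisonOf (FreeGroup.of 0, 1))⁻¹, (poisonOf (FreeGroup.of 1, 1))⁻¹,
    poisonT * poisonT]

theorem poisonOf_left_eq (g : FreeGroup (Fin 2)) :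
    poisonOf (g, 1) = poisonT * poisonOf (g, g) * poisonT⁻¹ := by
  rw [poisonT_mul_of_diag, mul_inv_cancel_right]

theorem pconj_conj_poisonT (g : FreeGroup (Fin 2)) :
    pconj (poisonT * poisonOf (g, 1) * poisonT⁻¹) (poisonT * poisonT) = poisonOf (g, g) := by
  rw [poisonOf_left_eq, pconj]
  group

theorem conj_poisonT_mul (g : FreeGroup (Fin 2)) :
    poisonT * poisonOf (g, 1) * poisonT⁻¹ * (poisonOf (g, 1))⁻¹ =
      poisonT * poisonOf (1, g⁻¹) * poisonT⁻¹ := by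
  have h : poisonOf (1, g⁻¹) = poisonOf (g, 1) * (poisonOf (g, g))⁻¹ := by
    simp [← map_inv, ← map_mul]
  rw [h]
  conv_lhs => rw [poisonOf_left_eq g]
  conv_rhs => rw [poisonOf_left_eq g]
  group

theorem poisonOf_diag_mul_inv (g : FreeGroup (Fin 2)) :
    poisonOf (g, g) * (poisonOf (g, 1))⁻¹ = poisonOf (1, g) := by
  simp [← map_inv, ← map_mul]

theorem commute_conj_poisonT_inv (g : FreeGroup (Fin 2)) :
    Commute (poisonT * poisonOf (g, 1) * poisonT⁻¹) (poisonOf (g, 1))⁻¹ := by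
  rw [poisonOf_left_eq]
  conv_lhs => rw [← poisonOf_left_eq]
  refine Commute.inv_right ?_
  rw [← MulAut.conj_apply, ← MulAut.conj_apply]
  refine Commute.map ?_ _
  simp [Commute, SemiconjBy, ← map_mul]

/-- The homomorphism from `H` to the poison group. -/
noncomputable def h5ToPoison : H5 →* PoisonGroup :=
  PresentedGroup.toGroup (f := poisonGen) (by
    have hd : ∀ g, Commute (poisonOf (g, g)) (poisonOf (g, 1))⁻¹ := fun g =>
      Commute.inv_right (by simp [Commute, SemiconjBy, ← map_mul])
    have hc : ∀ g h, Commute (poisonT * poisonOf (1, g) * poisonT⁻¹)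
        (poisonT * poisonOf (h, 1) * poisonT⁻¹) := by
      intro g h
      rw [← MulAut.conj_apply, ← MulAut.conj_apply]
      exact (commute_poisonOf h g).symm.map _
    have hr : ∀ g h, Commute (poisonOf (1, g)) (poisonOf (h, 1))⁻¹ := fun g h =>
      (commute_poisonOf h g).symm.inv_right
    intro r hr
    simp only [relsH5, Set.mem_insert_iff, Set.mem_singleton_iff] at hr
    rcases hr with rfl | rfl | rfl | rfl | rfl | rfl | rfl | rfl <;>
      simp only [map_pcomm, map_pconj, map_mul, FreeGroup.lift_apply_of, poisonGen, Fin.isValue,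
        Matrix.cons_val, pconj_conj_poisonT, conj_poisonT_mul, poisonOf_diag_mul_inv] <;>
      apply pcomm_eq_one_of_commute
    · exact commute_conj_poisonT_inv _
    · exact commute_conj_poisonT_inv _
    · exact hd _
    · exact hd _
    · exact hc _ _
    · exact hc _ _
    · exact hr _ _
    · exact hr _ _)

theorem h5ToPoison_gen (i : Fin 5) : h5ToPoison (h5Gen i) = poisonGen i :=
  PresentedGroup.toGroup.of _

theorem h5ToPoison_vertex (p : FreeGroup (Fin 2) × FreeGroup (Fin 2)) :
    h5ToPoison (h5Vertex p) = poisonOf p := by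
  have h1 : h5ToPoison.comp (h5Vertex.comp (MonoidHom.inl _ _)) =
      poisonOf.comp (MonoidHom.inl _ _) := by
    apply FreeGroup.ext_hom
    intro i
    fin_cases i <;> simp [h5Vertex, h5ToPoison_gen, poisonGen]
  have h2 : h5ToPoison.comp (h5Vertex.comp (MonoidHom.inr _ _)) =
      poisonOf.comp (MonoidHom.inr _ _) := by
    apply FreeGroup.ext_hom
    intro i
    fin_cases i <;> simp [h5Vertex, h5ToPoison_gen, poisonGen, map_pconj, pconj_conj_poisonT,
      poisonOf_diag_mul_inv]
  have hp : p = (p.1, 1) * (1, p.2) := by simp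
  rw [hp, map_mul, map_mul, map_mul]
  exact congrArg₂ _ (DFunLike.congr_fun h1 p.1) (DFunLike.congr_fun h2 p.2)

theorem h5Vertex_injective : Function.Injective h5Vertex := by
  intro p q h
  apply poisonOf_injective
  rw [← h5ToPoison_vertex, h, h5ToPoison_vertex]

theorem induced_h5ToPoison {R : Type*} [Ring R] (ψ : H5 →* R) (h : H5) :
    (induced ψ (h5ToPoison h)).val 0 0 = ψ h := by
  let S : Subgroup H5 :=
    { carrier := {h | (induced ψ (h5ToPoison h)).val 0 0 = ψ h ∧
        (induced ψ (h5ToPoison h)).val 0 1 = 0 ∧ (induced ψ (h5ToPoison h)).val 1 0 = 0}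
      one_mem' := by simp
      mul_mem' := by
        rintro a b ⟨ha, ha', ha''⟩ ⟨hb, hb', hb''⟩
        simp [Matrix.mul_apply, Fin.sum_univ_two, ha, ha', ha'', hb, hb', hb'']
      inv_mem' := by
        rintro a ⟨ha, ha', ha''⟩
        have h1 := (induced ψ (h5ToPoison a)).mul_inv
        have h2 := (induced ψ (h5ToPoison a)).inv_mul
        have hψ : ψ a⁻¹ * ψ a = 1 := by rw [← map_mul, inv_mul_cancel, map_one]
        have hψ' : ψ a * ψ a⁻¹ = 1 := by rw [← map_mul, mul_inv_cancel, map_one]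
        have h3 := congrFun (congrFun h1 0) 0
        have h4 := congrFun (congrFun h1 0) 1
        have h5 := congrFun (congrFun h2 1) 0
        simp only [Matrix.mul_apply, Fin.sum_univ_two, ha, ha', ha'', zero_mul, mul_zero, add_zero,
          Matrix.one_apply, if_true] at h3 h4 h5
        simp only [Set.mem_ofPred_eq, map_inv]
        refine ⟨?_, ?_, ?_⟩
        · rw [← one_mul ((induced ψ (h5ToPoison a))⁻¹.val 0 0), ← hψ, mul_assoc, h3, mul_one]
        · rw [← one_mul ((induced ψ (h5ToPoison a))⁻¹.val 0 1), ← hψ, mul_assoc, h4]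
          simp
        · rw [← mul_one ((induced ψ (h5ToPoison a))⁻¹.val 1 0), ← hψ', ← mul_assoc, h5]
          simp }
  have hS : ∀ i, h5Gen i ∈ S := by
    intro i
    change _ ∧ _ ∧ _
    fin_cases i <;>
      simp [h5ToPoison_gen, poisonGen, induced_of_val, induced_t_val, induced_t_inv_val,
        induced_of_inv_val, h5Vertex, h5ConjVertex]
  have : (⊤ : Subgroup H5) ≤ S := by
    rw [← PresentedGroup.closure_range_of, Subgroup.closure_le]
    rintro _ ⟨i, rfl⟩
    exact hS i
  exact (this (Subgroup.mem_top h)).1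

theorem h5ToPoison_injective : Function.Injective h5ToPoison := by
  intro a b h
  apply MonoidAlgebra.of_injective (R := ℤ)
  rw [← induced_h5ToPoison, h, induced_h5ToPoison]

/-- The parity of the exponent sum of the stable letter. -/
noncomputable def poisonParity : PoisonGroup →* Multiplicative (ZMod 2) :=
  poisonLift 1 (Multiplicative.ofAdd 1) (by simp)

theorem poisonOf_mem_range (p : FreeGroup (Fin 2) × FreeGroup (Fin 2)) :
    poisonOf p ∈ h5ToPoison.range :=
  ⟨_, h5ToPoison_vertex p⟩

theorem poisonT_sq_mem_range : poisonT * poisonT ∈ h5ToPoison.range :=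
  ⟨h5Gen 4, by simp [h5ToPoison_gen, poisonGen]⟩

theorem conj_poisonT_mem_range {x : PoisonGroup} (hx : x ∈ h5ToPoison.range) :
    poisonT * x * poisonT⁻¹ ∈ h5ToPoison.range := by
  obtain ⟨h, rfl⟩ := hx
  have key : (⊤ : Subgroup H5) ≤
      h5ToPoison.range.comap ((MulAut.conj poisonT).toMonoidHom.comp h5ToPoison) := by
    rw [← PresentedGroup.closure_range_of, Subgroup.closure_le]
    rintro _ ⟨i, rfl⟩
    change poisonT * h5ToPoison (h5Gen i) * poisonT⁻¹ ∈ h5ToPoison.range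
    have h1 : ∀ g, poisonT * (poisonT * poisonOf (g, 1) * poisonT⁻¹) * poisonT⁻¹ ∈
        h5ToPoison.range := by
      intro g
      have := mul_mem (mul_mem poisonT_sq_mem_range (poisonOf_mem_range (g, 1)))
        (inv_mem poisonT_sq_mem_range)
      simpa [mul_assoc] using this
    have h2 : ∀ i, poisonT * (poisonOf (FreeGroup.of i, 1))⁻¹ * poisonT⁻¹ ∈
        h5ToPoison.range := by
      intro i
      have : poisonT * (poisonOf (FreeGroup.of i, 1))⁻¹ * poisonT⁻¹ =
        (poisonT * poisonOf (FreeGroup.of i, 1) * poisonT⁻¹)⁻¹ := by group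
      rw [this]
      refine inv_mem ?_
      fin_cases i
      · exact ⟨h5Gen 0, by simp [h5ToPoison_gen, poisonGen]⟩
      · exact ⟨h5Gen 1, by simp [h5ToPoison_gen, poisonGen]⟩
    rw [h5ToPoison_gen]
    fin_cases i
    · exact h1 _
    · exact h1 _
    · exact h2 0
    · exact h2 1
    · change poisonT * (poisonT * poisonT) * poisonT⁻¹ ∈ h5ToPoison.range
      simpa only [mul_assoc, mul_inv_cancel, mul_one] using poisonT_sq_mem_range
  exact key (Subgroup.mem_top h)

theorem mem_range_or_poisonT_mul_mem_range (x : PoisonGroup) :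
    x ∈ h5ToPoison.range ∨ poisonT * x ∈ h5ToPoison.range := by
  induction x using poison_induction with
  | of p => exact Or.inl (poisonOf_mem_range p)
  | t => exact Or.inr poisonT_sq_mem_range
  | mul x y hx hy =>
    rcases hx with hx | hx <;> rcases hy with hy | hy
    · exact Or.inl (mul_mem hx hy)
    · refine Or.inr ?_
      have := mul_mem (conj_poisonT_mem_range hx) hy
      simpa [mul_assoc] using this
    · refine Or.inr ?_
      simpa [mul_assoc] using mul_mem hx hy
    · refine Or.inl ?_
      have := mul_mem (inv_mem poisonT_sq_mem_range) (mul_mem (conj_poisonT_mem_range hx) hy)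
      simpa [mul_assoc] using this
  | inv x hx =>
    rcases hx with hx | hx
    · exact Or.inl (inv_mem hx)
    · refine Or.inr ?_
      have := mul_mem (conj_poisonT_mem_range (inv_mem hx)) poisonT_sq_mem_range
      simpa [mul_assoc] using this

theorem h5ToPoison_range : h5ToPoison.range = poisonParity.ker := by
  have hle : h5ToPoison.range ≤ poisonParity.ker := by
    rw [MonoidHom.range_eq_map, ← PresentedGroup.closure_range_of, MonoidHom.map_closure,
      Subgroup.closure_le]
    rintro _ ⟨_, ⟨i, rfl⟩, rfl⟩
    change poisonParity (h5ToPoison (h5Gen i)) = 1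
    rw [h5ToPoison_gen]
    fin_cases i <;> simp [poisonGen, poisonParity]
    rfl
  refine le_antisymm hle fun x hx => ?_
  refine (mem_range_or_poisonT_mul_mem_range x).resolve_right fun h => ?_
  have h1 := hle h
  rw [MonoidHom.mem_ker] at hx h1
  rw [map_mul, hx] at h1
  simp [poisonParity] at h1

theorem poisonParity_ker_index : poisonParity.ker.index = 2 := by
  have hs : Function.Surjective poisonParity := by
    intro x
    have h : ∀ x : ZMod 2, x = 0 ∨ x = 1 := by decide
    rcases h x.toAdd with h | h
    · exact ⟨1, by rw [map_one]; exact h.symm⟩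
    · exact ⟨poisonT, by simp only [poisonParity, poisonLift_t]; exact h.symm⟩
  rw [Subgroup.index_ker, MonoidHom.range_eq_top.2 hs]
  simp [Nat.card_eq_fintype_card]

theorem exists_normal_index_two_mulEquiv :
    ∃ N : Subgroup PoisonGroup, N.Normal ∧ N.index = 2 ∧ Nonempty (H5 ≃* N) :=
  ⟨h5ToPoison.range, h5ToPoison_range ▸ inferInstance, h5ToPoison_range ▸ poisonParity_ker_index,
    ⟨MonoidHom.ofInjective h5ToPoison_injective⟩⟩

end PoisonStructure

section Weights

/-- A commutative algebra acting on a finite-dimensional space over an algebraically closed field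
can be triangularized simultaneously: its determinants are products of characters. -/
theorem exists_multiset_algHom_det_eq_prod {K S : Type*} [Field K] [IsAlgClosed K] [CommRing S]
    [Algebra K S] (n : ℕ) : ∀ (V : Type*) [AddCommGroup V] [Module K V] [Module S V]
    [IsScalarTower K S V] [FiniteDimensional K V], Module.finrank K V = n →
    ∃ s : Multiset (S →ₐ[K] K), ∀ a : S,
      LinearMap.det (Algebra.lsmul K K V a) = (s.map fun χ => χ a).prod := by
  induction n using Nat.strong_induction_on with
  | _ n ih =>
  intro V _ _ _ _ _ hn
  rcases subsingleton_or_nontrivial V with hV | hV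
  · refine ⟨0, fun a => ?_⟩
    rw [Subsingleton.elim (Algebra.lsmul K K V a) LinearMap.id, LinearMap.det_id]
    simp
  have hart : IsArtinian S V := isArtinian_of_tower K inferInstance
  obtain ⟨W, hW⟩ := IsAtomic.exists_atom (Submodule S V)
  have hWnt : Nontrivial W := Submodule.nontrivial_iff_ne_bot.2 hW.1
  have hscalar : ∀ a : S, ∃ c : K, ∀ w ∈ W, a • w = c • w := by
    intro a
    have hmap : ∀ w ∈ W.restrictScalars K, Algebra.lsmul K K V a w ∈ W.restrictScalars K :=
      fun w hw => W.smul_mem a hw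
    have : Nontrivial (W.restrictScalars K) := hWnt
    obtain ⟨c, hc⟩ := Module.End.exists_eigenvalue ((Algebra.lsmul K K V a).restrict hmap)
    obtain ⟨w, hw⟩ := hc.exists_hasEigenvector
    have hw1 := congrArg Subtype.val hw.apply_eq_smul
    simp only [LinearMap.restrict_apply, Algebra.lsmul_coe, Submodule.coe_smul] at hw1
    let U : Submodule S V := (LinearMap.lsmul S V (a - algebraMap K S c)).ker ⊓ W
    have hU : U = W := by
      refine (hW.le_iff.1 (inf_le_right : U ≤ W)).resolve_left fun h => ?_
      have hwU : w.1 ∈ U := by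
        refine ⟨?_, w.2⟩
        simp [hw1]
      exact hw.2 (Subtype.ext ((Submodule.mem_bot S).1 (h.le hwU)))
    refine ⟨c, fun v hv => ?_⟩
    rw [← hU] at hv
    have := hv.1
    simpa [sub_eq_zero] using this
  choose χ hχ using hscalar
  obtain ⟨w, hw0⟩ := exists_ne (0 : W)
  have hw0' : w.1 ≠ 0 := fun h => hw0 (Subtype.ext h)
  have huniq : ∀ {c d : K}, c • w.1 = d • w.1 → c = d := fun h => smul_left_injective K hw0' h
  let χ' : S →ₐ[K] K :=
    { toFun := χ
      map_one' := huniq (by rw [← hχ 1 w w.2, one_smul, one_smul])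
      map_mul' := fun a b => huniq (by
        rw [← hχ _ w w.2, mul_smul, hχ b w w.2, smul_comm, hχ a w w.2, smul_smul, mul_comm])
      map_zero' := huniq (by rw [← hχ 0 w w.2, zero_smul, zero_smul])
      map_add' := fun a b => huniq (by
        rw [← hχ _ w w.2, add_smul, hχ b w w.2, hχ a w w.2, add_smul])
      commutes' := fun c => huniq (by
        rw [← hχ _ w w.2, algebraMap_smul, Algebra.algebraMap_self_apply]) }
  have hlt : Module.finrank K (V ⧸ W) < n := by
    have h1 := (W.restrictScalars K).finrank_quotient_add_finrank
    have h2 : 0 < Module.finrank K (W.restrictScalars K) := by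
      have : Nontrivial (W.restrictScalars K) := hWnt
      exact Module.finrank_pos
    have h3 := (Submodule.Quotient.restrictScalarsEquiv K W).finrank_eq
    omega
  have hfd : FiniteDimensional K (V ⧸ W) :=
    Module.Finite.equiv (Submodule.Quotient.restrictScalarsEquiv K W)
  obtain ⟨s, hs⟩ := ih _ hlt (V ⧸ W) rfl
  refine ⟨Multiset.replicate (Module.finrank K (W.restrictScalars K)) χ' + s, fun a => ?_⟩
  have hmap : W.restrictScalars K ≤ (W.restrictScalars K).comap (Algebra.lsmul K K V a) :=
    fun w hw => W.smul_mem a hw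
  rw [LinearMap.det_eq_det_mul_det (W.restrictScalars K) _ hmap, Multiset.map_add,
    Multiset.prod_add, ← hs]
  congr 1
  have : LinearMap.restrict (p := W.restrictScalars K) (q := W.restrictScalars K)
      (Algebra.lsmul K K V a) hmap = χ a • LinearMap.id := by
    ext w
    exact hχ a w w.2
  rw [this, LinearMap.det_smul]
  simp [χ']

theorem exists_algHom_charpoly_eq_prod {K S V : Type*} [Field K] [IsAlgClosed K] [CommRing S]
    [Algebra K S] [AddCommGroup V] [Module K V] [Module S V] [IsScalarTower K S V]
    [FiniteDimensional K V] :
    ∃ χ : Fin (Module.finrank K V) → (S →ₐ[K] K), ∀ a : S,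
      LinearMap.det (Algebra.lsmul K K V a) = ∏ i, χ i a ∧
      (Algebra.lsmul K K V a).charpoly = ∏ i, (Polynomial.X - Polynomial.C (χ i a)) := by
  obtain ⟨s, hs⟩ := exists_multiset_algHom_det_eq_prod (K := K) (S := S) _ V rfl
  have hchar : ∀ a : S, (Algebra.lsmul K K V a).charpoly =
      (s.map fun χ => Polynomial.X - Polynomial.C (χ a)).prod := by
    intro a
    refine Polynomial.funext fun c => ?_
    have h : algebraMap K (V →ₗ[K] V) c - Algebra.lsmul K K V a =
        Algebra.lsmul K K V (algebraMap K S c - a) := by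
      ext v
      simp
    rw [LinearMap.eval_charpoly, h, hs, Polynomial.eval_multiset_prod, Multiset.map_map]
    simp
  have hcard : s.card = Module.finrank K V := by
    rw [← LinearMap.charpoly_natDegree (Algebra.lsmul K K V (0 : S)), hchar,
      Polynomial.natDegree_multiset_prod_of_monic]
    · simp
    · simp only [Multiset.mem_map]
      rintro _ ⟨χ, -, rfl⟩
      exact Polynomial.monic_X_sub_C _
  obtain ⟨l, rfl⟩ : ∃ l : List (S →ₐ[K] K), (l : Multiset (S →ₐ[K] K)) = s := Quot.exists_rep s
  rw [Multiset.coe_card] at hcard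
  rw [← hcard]
  refine ⟨l.get, fun a => ⟨?_, ?_⟩⟩
  · rw [hs, Multiset.map_coe, Multiset.prod_coe, ← List.prod_ofFn]
    congr 1
    conv_lhs => rw [← List.ofFn_get l, List.map_ofFn]
    rfl
  · rw [hchar, Multiset.map_coe, Multiset.prod_coe, ← List.prod_ofFn]
    congr 1
    conv_lhs => rw [← List.ofFn_get l, List.map_ofFn]
    rfl

/-- A polynomial whose value at `A` is the projection to the generalized eigenspace of `c`. -/
theorem exists_spectral_projection {K V : Type*} [Field K] [AddCommGroup V] [Module K V]
    [FiniteDimensional K V] (A : Module.End K V) (c : K) :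
    ∃ q : Polynomial K, q.eval c = 1 ∧ (∀ d, d ≠ c → A.charpoly.eval d = 0 → q.eval d = 0) ∧
      IsIdempotentElem (Polynomial.aeval A q) ∧
      ∃ m, (A - algebraMap K _ c) ^ m * Polynomial.aeval A q = 0 := by
  obtain ⟨h, hh, hnd⟩ := A.charpoly.exists_eq_pow_rootMultiplicity_mul_and_not_dvd
    A.charpoly_monic.ne_zero c
  set k := A.charpoly.rootMultiplicity c
  have hcop : IsCoprime ((Polynomial.X - Polynomial.C c) ^ (k + 1)) h :=
    ((Polynomial.irreducible_X_sub_C c).coprime_iff_not_dvd.2 hnd).pow_left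
  obtain ⟨u, v, huv⟩ := hcop
  have hq : 1 - v * h = u * (Polynomial.X - Polynomial.C c) ^ (k + 1) := by
    rw [← huv]; ring
  refine ⟨v * h, ?_, ?_, ?_, k, ?_⟩
  · have := congrArg (Polynomial.eval c) huv
    simpa using this
  · intro d hd hroot
    rw [hh, Polynomial.eval_mul, Polynomial.eval_pow] at hroot
    have : (Polynomial.X - Polynomial.C c).eval d ≠ 0 := by simpa [sub_eq_zero] using hd
    rw [Polynomial.eval_mul, (mul_eq_zero.1 hroot).resolve_left (pow_ne_zero _ this), mul_zero]
  · have h0 : Polynomial.aeval A (v * h * (1 - v * h)) = 0 := by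
      have : v * h * (1 - v * h) =
          (v * u * (Polynomial.X - Polynomial.C c)) * A.charpoly := by
        rw [hq, hh]; ring
      rw [this, map_mul, LinearMap.aeval_self_charpoly, mul_zero]
    rw [map_mul, map_sub, map_one, mul_sub, mul_one, sub_eq_zero] at h0
    exact h0.symm
  · have h0 : Polynomial.aeval A ((Polynomial.X - Polynomial.C c) ^ k * (v * h)) = 0 := by
      have : (Polynomial.X - Polynomial.C c) ^ k * (v * h) = v * A.charpoly := by
        rw [hh]; ring
      rw [this, map_mul, LinearMap.aeval_self_charpoly, mul_zero]
    simpa using h0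

/-- A system of equations in a commutative group satisfied by the joint eigenvalues of the two
factors of a poison group, where `π` records which of the `α i` coincide. -/
def IsWeightSystem {ι Λ : Type*} [Fintype ι] [DecidableEq ι] [CommGroup Λ] (π : ι → ι)
    (σ : Equiv.Perm ι) (α β : ι → Λ) : Prop :=
  (∀ i, α i * β i = α (σ i)) ∧ (∀ i, α (π i) = α i) ∧
    ∀ c, ∏ i with π i = c, β i = 1

theorem exists_rat_addMonoidHom_ne_zero {M : Type*} [AddCommGroup M] {x : M}
    (hx : ¬ IsOfFinAddOrder x) : ∃ f : M →+ ℚ, f x ≠ 0 := by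
  have h0 : DivisibleHull.coeAddMonoidHom M x ≠ 0 := by
    intro h
    rw [← map_zero (DivisibleHull.coeAddMonoidHom M)] at h
    obtain ⟨u, hu⟩ := DivisibleHull.mk_eq_mk.1 h
    exact hx (isOfFinAddOrder_iff_nsmul_eq_zero.2 ⟨u, u.pos, by simpa using hu⟩)
  by_contra! hf
  refine h0 ((Module.forall_dual_apply_eq_zero_iff ℚ _).1 fun φ => ?_)
  exact hf (φ.toAddMonoidHom.comp (DivisibleHull.coeAddMonoidHom M))

theorem IsWeightSystem.isOfFinOrder {ι Λ : Type*} [Fintype ι] [DecidableEq ι] [CommGroup Λ]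
    {π : ι → ι} {σ : Equiv.Perm ι} {α β : ι → Λ} (h : IsWeightSystem π σ α β) (i : ι) :
    IsOfFinOrder (β i) := by
  by_contra hβ
  obtain ⟨f, hf⟩ := exists_rat_addMonoidHom_ne_zero (M := Additive Λ)
    (x := Additive.ofMul (β i)) (by rwa [isOfFinAddOrder_ofMul_iff])
  let v : Λ → ℚ := fun x => f (Additive.ofMul x)
  have hv : ∀ x y, v (x * y) = v x + v y := fun x y => by simp [v]
  obtain ⟨h1, h2, h3⟩ := h
  have hsq : ∑ j, (v (α j) + v (β j)) ^ 2 = ∑ j, v (α j) ^ 2 := by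
    rw [← Equiv.sum_comp σ fun j => v (α j) ^ 2]
    exact Finset.sum_congr rfl fun j _ => by rw [← hv, h1]
  have hmix : ∑ j, v (α j) * v (β j) = 0 := by
    rw [← Finset.sum_fiberwise Finset.univ π]
    refine Finset.sum_eq_zero fun c _ => ?_
    have hc : ∑ j with π j = c, v (β j) = 0 := by
      have := congrArg (fun x => f (Additive.ofMul x)) (h3 c)
      simpa [ofMul_prod, v] using this
    rw [← mul_zero (v (α c)), ← hc, Finset.mul_sum]
    refine Finset.sum_congr rfl fun j hj => ?_
    rw [← (Finset.mem_filter.1 hj).2, h2]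
  have hβ0 : ∑ j, v (β j) ^ 2 = 0 := by
    have : ∑ j, (v (α j) + v (β j)) ^ 2 =
        ∑ j, v (α j) ^ 2 + 2 * ∑ j, v (α j) * v (β j) + ∑ j, v (β j) ^ 2 := by
      rw [Finset.mul_sum, ← Finset.sum_add_distrib, ← Finset.sum_add_distrib]
      exact Finset.sum_congr rfl fun j _ => by ring
    rw [hsq, hmix] at this
    linarith
  have := (Finset.sum_eq_zero_iff_of_nonneg fun j _ => sq_nonneg (v (β j))).1 hβ0 i
    (Finset.mem_univ i)
  exact hf (pow_eq_zero_iff two_ne_zero |>.1 this)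

/-- The exponent in `IsWeightSystem.isOfFinOrder` can be chosen uniformly. -/
theorem exists_uniform_exponent (ι Λ : Type*) [Fintype ι] [DecidableEq ι] [CommGroup Λ] :
    ∃ N : ℕ, 0 < N ∧ ∀ (π : ι → ι) (σ : Equiv.Perm ι) (α β : ι → Λ),
      IsWeightSystem π σ α β → ∀ i, β i ^ N = 1 := by
  have key : ∀ (π : ι → ι) (σ : Equiv.Perm ι) (i : ι), ∃ N : ℕ, 0 < N ∧
      ∀ α β : ι → Λ, IsWeightSystem π σ α β → β i ^ N = 1 := by
    intro π σ i
    let T := {p : (ι → Λ) × (ι → Λ) // IsWeightSystem π σ p.1 p.2}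
    have hT : IsWeightSystem (Λ := T → Λ) π σ (fun i p => p.1.1 i) (fun i p => p.1.2 i) := by
      refine ⟨fun i => ?_, fun i => ?_, fun c => ?_⟩
      · ext p
        exact p.2.1 i
      · ext p
        exact p.2.2.1 i
      · ext p
        simpa using p.2.2.2 c
    obtain ⟨N, hN, h⟩ := isOfFinOrder_iff_pow_eq_one.1 (hT.isOfFinOrder i)
    exact ⟨N, hN, fun α β hαβ => congrFun h ⟨(α, β), hαβ⟩⟩
  choose N hN h using key
  refine ⟨∏ π, ∏ σ, ∏ i, N π σ i,
    Finset.prod_pos fun _ _ => Finset.prod_pos fun _ _ => Finset.prod_pos fun _ _ => hN _ _ _,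
    fun π σ α β hαβ i => ?_⟩
  have hdvd : N π σ i ∣ ∏ π, ∏ σ, ∏ i, N π σ i :=
    (Finset.dvd_prod_of_mem _ (Finset.mem_univ i)).trans
      ((Finset.dvd_prod_of_mem (fun σ => ∏ i, N π σ i) (Finset.mem_univ σ)).trans
        (Finset.dvd_prod_of_mem (fun π => ∏ σ, ∏ i, N π σ i) (Finset.mem_univ π)))
  obtain ⟨m, hm⟩ := hdvd
  rw [hm, pow_mul, h π σ i α β hαβ, one_pow]

theorem exists_perm_comp_eq_of_prod_X_sub_C {ι K : Type*} [Fintype ι] [Field K]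
    {f g : ι → K} (h : ∏ i, (Polynomial.X - Polynomial.C (f i)) =
      ∏ i, (Polynomial.X - Polynomial.C (g i))) :
    ∃ σ : Equiv.Perm ι, ∀ i, f i = g (σ i) := by
  classical
  have hroots : ∀ f : ι → K, (∏ i, (Polynomial.X - Polynomial.C (f i))).roots =
      Finset.univ.val.map f := by
    intro f
    rw [← Polynomial.roots_multiset_prod_X_sub_C (Finset.univ.val.map f), Multiset.map_map]
    rfl
  have hfg : Finset.univ.val.map f = Finset.univ.val.map g := by rw [← hroots, h, hroots]
  have hcard : ∀ c, Fintype.card {i // f i = c} = Fintype.card {i // g i = c} := by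
    intro c
    have := congrArg (Multiset.count c) hfg
    rw [Multiset.count_map, Multiset.count_map] at this
    simpa [Fintype.card_subtype, Finset.card_def, eq_comm] using this
  refine ⟨Equiv.ofFiberEquiv fun c => Fintype.equivOfCardEq (hcard c), fun i => ?_⟩
  exact (Equiv.ofFiberEquiv_map (g := g) _ i).symm

theorem LinearMap.charpoly_units_conj {K V : Type*} [Field K] [AddCommGroup V] [Module K V]
    [FiniteDimensional K V] (T : (Module.End K V)ˣ) (A : Module.End K V) :
    (T.val * A * T⁻¹.val).charpoly = A.charpoly :=
  LinearEquiv.charpoly_conj (LinearMap.GeneralLinearGroup.toLinearEquiv T) A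

/-- If `e` is an idempotent commuting with a representation `R`, then the determinant of `R` on
the image of `e` is trivial on the commutator subgroup. -/
theorem det_mul_idempotent_eq_one {K V F : Type*} [Field K] [AddCommGroup V] [Module K V]
    [Group F] (R : F →* Module.End K V) {e : Module.End K V}
    (he : IsIdempotentElem e) (hcomm : ∀ g, Commute e (R g)) {g : F} (hg : g ∈ commutator F) :
    LinearMap.det (R g * e + (1 - e)) = 1 := by
  let D : F →* K :=
    { toFun := fun g => LinearMap.det (R g * e + (1 - e))
      map_one' := by simp
      map_mul' := fun x y => by
        rw [← map_mul]
        congr 1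
        have h1 : R x * e * (R y * e) = R x * R y * e := by
          rw [mul_assoc, ← mul_assoc e, (hcomm y).eq, mul_assoc (R y), he.eq, ← mul_assoc]
        have h2 : e * (R y * e) = R y * e := by
          rw [← mul_assoc, (hcomm y).eq, mul_assoc, he.eq]
        rw [map_mul]
        simp only [add_mul, sub_mul, mul_add, mul_sub, h1, h2, mul_assoc, he.eq, one_mul, mul_one]
        abel }
  have := Abelianization.commutator_subset_ker D.toHomUnits hg
  exact congrArg Units.val this

/-- In a representation of a poison group, the eigenvalues of the right factor on the commutator
subgroup are roots of unity of bounded order. -/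
theorem exists_charpoly_eq_prod_of_mem_commutator {K V F : Type*} [Field K] [IsAlgClosed K]
    [AddCommGroup V] [Module K V] [FiniteDimensional K V] [Group F] (L R : F →* Module.End K V)
    (T : (Module.End K V)ˣ) (hcomm : ∀ g h, Commute (L g) (R h))
    (hT : ∀ g, T.val * (L g * R g) = L g * T.val) :
    ∃ N : ℕ, 0 < N ∧ ∀ g ∈ commutator F, ∃ β : Fin (Module.finrank K V) → K,
      (R g).charpoly = ∏ i, (Polynomial.X - Polynomial.C (β i)) ∧ ∀ i, β i ^ N = 1 := by
  classical
  obtain ⟨N, hN, hexp⟩ := exists_uniform_exponent (Fin (Module.finrank K V)) Kˣ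
  refine ⟨N, hN, fun g hg => ?_⟩
  set A := L g
  set B := R g
  let S := Algebra.adjoin K {A, B}
  have hS : IsMulCommutative S := by
    refine Algebra.isMulCommutative_adjoin K ?_
    have := (hcomm g g).eq
    rintro x (rfl | rfl) y (rfl | rfl) <;> first | rfl | exact this | exact this.symm
  open scoped IsMulCommutative in
  obtain ⟨χ, hχ⟩ := exists_algHom_charpoly_eq_prod (K := K) (S := S) (V := V)
  have hval : ∀ a : S, Algebra.lsmul K K V a = a.1 := fun a => rfl
  simp only [hval] at hχ
  let a : S := ⟨A, Algebra.subset_adjoin (by simp)⟩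
  let b : S := ⟨B, Algebra.subset_adjoin (by simp)⟩
  have hunit : ∀ g : F, LinearMap.det (L g) ≠ 0 ∧ LinearMap.det (R g) ≠ 0 := fun g =>
    ⟨(((Group.isUnit g).map L).map LinearMap.det).ne_zero,
      (((Group.isUnit g).map R).map LinearMap.det).ne_zero⟩
  have ha0 : ∀ i, χ i a ≠ 0 := by
    have := (hχ a).1 ▸ (hunit g).1
    exact fun i => Finset.prod_ne_zero_iff.1 this i (Finset.mem_univ i)
  have hb0 : ∀ i, χ i b ≠ 0 := by
    have := (hχ b).1 ▸ (hunit g).2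
    exact fun i => Finset.prod_ne_zero_iff.1 this i (Finset.mem_univ i)
  have hAB : (A * B).charpoly = A.charpoly := by
    rw [← LinearMap.charpoly_units_conj T (A * B), hT, mul_assoc, Units.mul_inv, mul_one]
  obtain ⟨σ, hσ⟩ := exists_perm_comp_eq_of_prod_X_sub_C
    (((hχ (a * b)).2.symm.trans hAB).trans (hχ a).2)
  let α : Fin (Module.finrank K V) → Kˣ := fun i => Units.mk0 (χ i a) (ha0 i)
  let β : Fin (Module.finrank K V) → Kˣ := fun i => Units.mk0 (χ i b) (hb0 i)
  let π : Fin (Module.finrank K V) → Fin (Module.finrank K V) := fun i =>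
    (⟨i, rfl⟩ : ∃ j, α j = α i).choose
  have hπ : ∀ i, α (π i) = α i := fun i => (⟨i, rfl⟩ : ∃ j, α j = α i).choose_spec
  have hπ' : ∀ i j, α i = α j → π i = π j := by
    intro i j hij
    simp only [π, hij]
  have hprod : ∀ c : K, ∏ i, (if χ i a = c then χ i b else 1) = 1 := by
    intro c
    obtain ⟨q, hq1, hq0, hidem, -⟩ := exists_spectral_projection A c
    let e : S := Polynomial.aeval a q
    have hae : (e : Module.End K V) = Polynomial.aeval A q := by
      simp [e, a]
    rw [← hae] at hidem
    have hc : ∀ h, Commute (e : Module.End K V) (R h) := by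
      intro h
      rw [hae]
      exact (Algebra.commute_of_mem_adjoin_singleton_of_commute
        (Polynomial.aeval_mem_adjoin_singleton K A) (hcomm g h).symm).symm
    have hdet := det_mul_idempotent_eq_one R hidem hc hg
    rw [show R g * (e : Module.End K V) + (1 - e) = (b * e + (1 - e) : S).1 from rfl,
      (hχ _).1] at hdet
    refine Eq.trans ?_ hdet
    refine Finset.prod_congr rfl fun i _ => ?_
    have hχe : χ i e = q.eval (χ i a) := by
      simp [e, ← Polynomial.aeval_algHom_apply]
    rw [map_add, map_mul, map_sub, map_one, hχe]
    split_ifs with hi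
    · simp [hi, hq1]
    · rw [hq0 _ hi]
      · simp
      · rw [show A = a.1 from rfl, (hχ a).2, Polynomial.eval_prod]
        exact Finset.prod_eq_zero (Finset.mem_univ i) (by simp)
  refine ⟨fun i => χ i b, (hχ b).2, fun i => ?_⟩
  have hsys : IsWeightSystem π σ α β := by
    refine ⟨fun i => ?_, hπ, fun c => ?_⟩
    · ext
      simpa [α, β] using hσ i
    · by_cases hc : π c = c
      · ext
        rw [Units.coe_prod, Finset.prod_filter]
        refine Eq.trans ?_ (hprod (χ c a))
        refine Finset.prod_congr rfl fun i _ => ?_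
        have : π i = c ↔ χ i a = χ c a := by
          constructor
          · rintro rfl
            exact (congrArg Units.val (hπ i)).symm
          · intro h
            rw [hπ' i c (Units.ext h), hc]
        simp only [this, β, Units.val_mk0]
      · rw [Finset.filter_eq_empty_iff.2, Finset.prod_empty]
        rintro i - rfl
        exact hc (hπ' _ _ (hπ i))
  exact congrArg Units.val (hexp π σ α β hsys i)

end Weights

section TraceRadical

/-- The group of units congruent to `1` modulo a nilpotent ideal is nilpotent. -/
theorem isNilpotent_of_sub_one_mem {G S : Type*} [Group G] [Ring S] (φ : G →* S)
    (hφ : Function.Injective φ) (I : Ideal S) [I.IsTwoSided] {k : ℕ} (hI : I ^ k = ⊥)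
    (h : ∀ g, φ g - 1 ∈ I) : Group.IsNilpotent G := by
  let H : ℕ → Subgroup G := fun j =>
    if j = 0 then ⊤ else ((Ideal.Quotient.mk (I ^ j)).toMonoidHom.comp φ).ker
  have hmem : ∀ j g, g ∈ H j ↔ φ g - 1 ∈ I ^ j := by
    intro j g
    rcases eq_or_ne j 0 with rfl | hj
    · have h0 : I ^ 0 = ⊤ := by rw [Submodule.pow_zero, Ideal.one_eq_top]
      rw [h0]
      simp [H]
    · simp only [H, if_neg hj, MonoidHom.mem_ker]
      rw [← Ideal.Quotient.eq]
      rfl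
  refine (Subgroup.nilpotent_iff_finite_descending_central_series _).2 ⟨k, H, ⟨by simp [H], ?_⟩, ?_⟩
  · intro x j hx g
    rw [hmem] at hx ⊢
    have hcomm : φ (x * g * x⁻¹ * g⁻¹) - 1 =
        ((φ x - 1) * (φ g - 1) - (φ g - 1) * (φ x - 1)) * (φ x⁻¹ * φ g⁻¹) := by
      have h1 : (φ x - 1) * (φ g - 1) - (φ g - 1) * (φ x - 1) = φ (x * g) - φ (g * x) := by
        rw [map_mul, map_mul]
        noncomm_ring
      rw [h1, ← map_mul, sub_mul, ← map_mul, ← map_mul, ← map_one φ]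
      congr 2 <;> group
    rw [commutatorElement_def, hcomm]
    refine Ideal.mul_mem_right _ _ (sub_mem ?_ ?_)
    · rw [Submodule.pow_succ]
      exact Ideal.mul_mem_mul hx (h g)
    · rw [Ideal.IsTwoSided.pow_succ]
      exact Ideal.mul_mem_mul (h g) hx
  · rw [eq_bot_iff]
    intro g hg
    rw [hmem, hI, Submodule.mem_bot, sub_eq_zero, ← map_one φ] at hg
    exact hφ hg

/-- The radical of the trace form of a subalgebra of an endomorphism algebra. -/
def traceRadical {K V : Type*} [Field K] [AddCommGroup V] [Module K V]
    (S : Subalgebra K (Module.End K V)) : Ideal S where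
  carrier := {x | ∀ y : S, LinearMap.trace K V (x.1 * y.1) = 0}
  zero_mem' y := by simp
  add_mem' {a b} ha hb y := by
    rw [Subalgebra.coe_add, add_mul, map_add, ha y, hb y, add_zero]
  smul_mem' c x hx y := by
    have := hx (y * c)
    rwa [smul_eq_mul, Subalgebra.coe_mul, mul_assoc, LinearMap.trace_mul_comm, mul_assoc]

instance {K V : Type*} [Field K] [AddCommGroup V] [Module K V]
    (S : Subalgebra K (Module.End K V)) : (traceRadical S).IsTwoSided where
  mul_mem_of_left c hx y := by
    rw [Subalgebra.coe_mul, mul_assoc]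
    exact hx (c * y)

theorem isNilpotent_of_mem_traceRadical {K V : Type*} [Field K] [CharZero K] [AddCommGroup V]
    [Module K V] [FiniteDimensional K V] {S : Subalgebra K (Module.End K V)} {x : S}
    (hx : x ∈ traceRadical S) : IsNilpotent x := by
  obtain ⟨q, hq, -, hidem, m, hm⟩ := exists_spectral_projection x.1 0
  obtain ⟨r, hr⟩ : Polynomial.X ∣ 1 - q := by
    rw [Polynomial.X_dvd_iff, Polynomial.coeff_zero_eq_eval_zero]
    simp [hq]
  have hval : ∀ p : Polynomial K, ((Polynomial.aeval x p : S) : Module.End K V) =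
      Polynomial.aeval x.1 p :=
    fun p => (Polynomial.aeval_algHom_apply S.val x p).symm
  have htr : LinearMap.trace K V (1 - Polynomial.aeval x.1 q) = 0 := by
    have := hx (Polynomial.aeval x r)
    rw [hval] at this
    rw [← this, ← map_one (Polynomial.aeval (R := K) x.1), ← map_sub, hr, map_mul,
      Polynomial.aeval_X]
  have h1 := sub_eq_zero.1 (LinearMap.IsIdempotentElem.eq_zero_of_trace_eq_zero hidem.one_sub htr)
  rw [← h1, map_zero, sub_zero, mul_one] at hm
  exact ⟨m, Subtype.ext (by simpa using hm)⟩

theorem isNilpotent_traceRadical {K V : Type*} [Field K] [CharZero K] [AddCommGroup V]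
    [Module K V] [FiniteDimensional K V] (S : Subalgebra K (Module.End K V)) :
    IsNilpotent (traceRadical S) := by
  have : IsArtinianRing S := IsArtinianRing.of_finite K S
  have hle : traceRadical S ≤ Ring.jacobson S := by
    intro x hx
    rw [← Ideal.jacobson_bot, Ideal.mem_jacobson_iff]
    intro y
    have hnil := isNilpotent_of_mem_traceRadical ((traceRadical S).mul_mem_left y hx)
    obtain ⟨u, hu⟩ := hnil.isUnit_one_add
    refine ⟨↑u⁻¹, ?_⟩
    rw [Submodule.mem_bot, mul_assoc, sub_eq_zero]
    calc (↑u⁻¹ : S) * (y * x) + ↑u⁻¹ = ↑u⁻¹ * (1 + y * x) := by rw [mul_add, mul_one, add_comm]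
      _ = 1 := by rw [← hu, Units.inv_mul]
  obtain ⟨k, hk⟩ := IsArtinianRing.isNilpotent_jacobson_bot (R := S)
  refine ⟨k, ?_⟩
  rw [Ideal.zero_eq_bot, eq_bot_iff, ← Ideal.zero_eq_bot, ← hk]
  exact Ideal.pow_right_mono (hle.trans Ideal.jacobson_bot.ge) k

/-- If the traces of a representation take finitely many values then every element has a power
that acts as the identity modulo the radical of the trace form. -/
theorem exists_pow_sub_one_mem_traceRadical {K V Γ : Type*} [Field K] [AddCommGroup V]
    [Module K V] [FiniteDimensional K V] [Group Γ] (R : Γ →* Module.End K V)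
    (hR : (Set.range fun g => LinearMap.trace K V (R g)).Finite)
    (φ : Γ →* Algebra.adjoin K (Set.range R)) (hφ : ∀ g, (φ g).1 = R g) (x : Γ) :
    ∃ m, 0 < m ∧ φ (x ^ m) - 1 ∈ traceRadical (Algebra.adjoin K (Set.range R)) := by
  have hspan : Subalgebra.toSubmodule (Algebra.adjoin K (Set.range R)) =
      Submodule.span K (Set.range R) := by
    rw [Algebra.adjoin_eq_span, ← MonoidHom.coe_mrange, Submonoid.closure_eq]
  obtain ⟨s, hs, hspan'⟩ := (Submodule.fg_span_iff_fg_span_finset_subset (R := K)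
    (Set.range R)).1 (IsNoetherian.noetherian _)
  let Φ : ℕ → s → K := fun k y => LinearMap.trace K V (R (x ^ k) * y.1)
  have hfin : (Set.range Φ).Finite := by
    refine (Set.Finite.pi' fun _ : s => hR).subset ?_
    rintro _ ⟨k, rfl⟩ y
    obtain ⟨g, hg⟩ := hs y.2
    exact ⟨x ^ k * g, by simp only [Φ, map_mul, hg]⟩
  obtain ⟨k, -, l, -, hkl, hΦ⟩ := Set.infinite_univ.exists_lt_map_eq_of_mapsTo
    (fun k _ => Set.mem_range_self k) hfin
  have hmem : φ (x ^ l) - φ (x ^ k) ∈ traceRadical (Algebra.adjoin K (Set.range R)) := by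
    intro y
    obtain ⟨y, hyS⟩ := y
    have hy : y ∈ Submodule.span K (s : Set (Module.End K V)) := by
      rw [← hspan', ← hspan]
      exact hyS
    rw [Subalgebra.coe_sub, hφ, hφ]
    change LinearMap.trace K V ((R (x ^ l) - R (x ^ k)) * y) = 0
    clear hyS
    induction hy using Submodule.span_induction with
    | mem z hz =>
      rw [sub_mul, map_sub, sub_eq_zero]
      exact (congrFun hΦ ⟨z, hz⟩).symm
    | zero => simp
    | add a b _ _ ha hb => rw [mul_add, map_add, ha, hb, add_zero]
    | smul c a _ ha => rw [mul_smul_comm, map_smul, ha, smul_zero]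
  refine ⟨l - k, Nat.sub_pos_of_lt hkl, ?_⟩
  have := Ideal.mul_mem_left _ (φ (x ^ k)⁻¹) hmem
  rwa [mul_sub, ← map_mul, ← map_mul, inv_mul_cancel, map_one, ← pow_mul_pow_sub x hkl.le,
    inv_mul_cancel_left] at this

end TraceRadical

section FreeGroups

/-- A group whose image in the symmetric group of degree three contains two distinct transpositions
is not nilpotent. -/
theorem not_isNilpotent_of_map_swap {G : Type*} [Group G] (f : G →* Equiv.Perm (Fin 3))
    {x y : G} (hx : f x = Equiv.swap 0 1) (hy : f y = Equiv.swap 1 2) : ¬ Group.IsNilpotent G := by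
  intro h
  have hlow : ∀ n, ∃ z ∈ (⊤ : Subgroup G).lowerCentralSeries n,
      f z = Equiv.swap 0 1 * Equiv.swap 1 2 ∨ f z = Equiv.swap 1 2 * Equiv.swap 0 1 := by
    intro n
    induction n with
    | zero => exact ⟨x * y, Subgroup.mem_top _, Or.inl (by rw [map_mul, hx, hy])⟩
    | succ n ih =>
      obtain ⟨z, hz, hfz⟩ := ih
      refine ⟨z * x * z⁻¹ * x⁻¹, Subgroup.commutator_mem_commutator hz (Subgroup.mem_top x), ?_⟩
      simp only [map_mul, map_inv, hx]
      rcases hfz with hfz | hfz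
      · exact Or.inr (by rw [hfz]; decide)
      · exact Or.inl (by rw [hfz]; decide)
  obtain ⟨n, hn⟩ := Subgroup.nilpotent_iff_lowerCentralSeries.1 h
  obtain ⟨z, hz, hfz⟩ := hlow n
  rw [hn, Subgroup.mem_bot] at hz
  rw [hz, map_one] at hfz
  revert hfz
  decide

theorem IsFreeGroup.commute_of_isNilpotent {G : Type*} [Group G] [IsFreeGroup G]
    [hG : Group.IsNilpotent G] (x y : G) : Commute x y := by
  classical
  have hsub : Subsingleton (IsFreeGroup.Generators G) := by
    refine ⟨fun i j => ?_⟩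
    by_contra hij
    refine not_isNilpotent_of_map_swap (IsFreeGroup.lift fun k =>
      if k = i then Equiv.swap (0 : Fin 3) 1 else Equiv.swap 1 2)
      (x := IsFreeGroup.of i) (y := IsFreeGroup.of j) ?_ ?_ hG
    · simp
    · simp [Ne.symm hij]
  have hcomm : IsMulCommutative (Subgroup.closure
      (Set.range (FreeGroup.of : IsFreeGroup.Generators G → _))) := by
    refine Subgroup.isMulCommutative_closure ?_
    rintro _ ⟨i, rfl⟩ _ ⟨j, rfl⟩
    rw [Subsingleton.elim i j]
  rw [FreeGroup.closure_range_of] at hcomm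
  refine (IsFreeGroup.toFreeGroup G).injective ?_
  rw [map_mul, map_mul]
  exact setLike_mul_comm (Subgroup.mem_top _) (Subgroup.mem_top _)

/-- Some two elements of the derived subgroup of `F₂` have no commuting powers. -/
theorem exists_forall_not_commute_pow : ∃ x ∈ commutator (FreeGroup (Fin 2)),
    ∃ y ∈ commutator (FreeGroup (Fin 2)), ∀ m n : ℕ, 0 < m → 0 < n →
      ¬ Commute (x ^ m) (y ^ n) := by
  let A : (Matrix (Fin 2) (Fin 2) ℤ)ˣ :=
    ⟨!![2, 1; 1, 1], !![1, -1; -1, 2], by decide, by decide⟩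
  let B : (Matrix (Fin 2) (Fin 2) ℤ)ˣ :=
    ⟨!![1, 1; 1, 2], !![2, -1; -1, 1], by decide, by decide⟩
  let f : FreeGroup (Fin 2) →* (Matrix (Fin 2) (Fin 2) ℤ)ˣ := FreeGroup.lift ![A, B]
  let a : FreeGroup (Fin 2) := FreeGroup.of 0
  let b : FreeGroup (Fin 2) := FreeGroup.of 1
  let x : FreeGroup (Fin 2) := (a * b * a⁻¹ * b⁻¹) ^ 2
  have hx : x ∈ commutator (FreeGroup (Fin 2)) :=
    pow_mem (Subgroup.commutator_mem_commutator (Subgroup.mem_top _) (Subgroup.mem_top _)) 2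
  have hfa : f a = A := by simp [f, a]
  have hfb : f b = B := by simp [f, b]
  have hfx : (f x).val = !![13, -12; 12, -11] := by
    simp only [x, map_pow, map_mul, map_inv, hfa, hfb]
    decide
  have hfy : (f (a * x * a⁻¹)).val = !![73, -108; 48, -71] := by
    rw [map_mul, map_mul, map_inv, Units.val_mul, Units.val_mul, hfx, hfa]
    decide
  have hpow : ∀ E : Matrix (Fin 2) (Fin 2) ℤ, E * E = 0 → ∀ k : ℕ,
      (1 + E) ^ k = 1 + (k : ℤ) • E := by
    intro E hE k
    induction k with
    | zero => simp
    | succ k ih =>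
      rw [pow_succ, ih, mul_add, mul_one, add_mul, one_mul, smul_mul_assoc, hE, smul_zero,
        Nat.cast_succ, add_smul, one_smul]
      abel
  refine ⟨x, hx, a * x * a⁻¹, Subgroup.Normal.conj_mem inferInstance x hx a, ?_⟩
  intro m n hm hn h
  have h1 := congrArg Units.val (h.map f).eq
  rw [Units.val_mul, Units.val_mul, map_pow f x, map_pow f _ n, Units.val_pow_eq_pow_val,
    Units.val_pow_eq_pow_val, hfx, hfy,
    show (!![13, -12; 12, -11] : Matrix (Fin 2) (Fin 2) ℤ) = 1 + !![12, -12; 12, -12] by decide,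
    show (!![73, -108; 48, -71] : Matrix (Fin 2) (Fin 2) ℤ) = 1 + !![72, -108; 48, -72] by decide,
    hpow _ (by decide), hpow _ (by decide)] at h1
  have h2 := congrFun (congrFun h1 0) 0
  simp [Matrix.mul_apply, Fin.sum_univ_two] at h2
  have : (0 : ℤ) < m * n := by positivity
  nlinarith

end FreeGroups

section NonLinear

/-- In a free linear group all of whose eigenvalues are roots of unity of bounded order, any two
elements have commuting powers. -/
theorem exists_commute_pow_of_charpoly {K V Γ : Type*} [Field K] [IsAlgClosed K]
    [AddCommGroup V] [Module K V] [FiniteDimensional K V] [Group Γ] [IsFreeGroup Γ]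
    (R : Γ →* Module.End K V) (hR : Function.Injective R) {N : ℕ} (hN : 0 < N)
    (hβ : ∀ g, ∃ β : Fin (Module.finrank K V) → K,
      (R g).charpoly = ∏ i, (Polynomial.X - Polynomial.C (β i)) ∧ ∀ i, β i ^ N = 1) (x y : Γ) :
    ∃ m n, 0 < m ∧ 0 < n ∧ Commute (x ^ m) (y ^ n) := by
  rcases CharP.exists' K with hK | ⟨p, hp, hK⟩
  · have hfin : (Set.range fun g => LinearMap.trace K V (R g)).Finite := by
      have hroots : {c : K | c ^ N = 1}.Finite := by
        refine (Polynomial.nthRootsFinset N (1 : K)).finite_toSet.subset fun c hc => ?_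
        exact (Polynomial.mem_nthRootsFinset hN 1).2 hc
      refine ((Set.Finite.pi' fun _ : Fin (Module.finrank K V) => hroots).image
        fun β => ∑ i, β i).subset ?_
      rintro _ ⟨g, rfl⟩
      obtain ⟨β, hβ, hβN⟩ := hβ g
      refine ⟨β, hβN, ?_⟩
      have hmap : ∏ i, (Polynomial.X - Polynomial.C (β i)) =
          ((Finset.univ.val.map β).map fun c => Polynomial.X - Polynomial.C c).prod := by
        rw [Multiset.map_map]
        rfl
      dsimp only
      rw [Module.End.trace_eq_sum_roots_charpoly_of_splits (IsAlgClosed.splits _), hβ, hmap,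
        Polynomial.roots_multiset_prod_X_sub_C]
      rfl
    let S := Algebra.adjoin K (Set.range R)
    let φ : Γ →* S := R.codRestrict S fun g => Algebra.subset_adjoin (Set.mem_range_self g)
    have hφ : Function.Injective φ := fun a b h => hR (congrArg Subtype.val h)
    let Γ₀ : Subgroup Γ := ((Ideal.Quotient.mk (traceRadical S)).toMonoidHom.comp φ).ker
    have hmem : ∀ g, g ∈ Γ₀ ↔ φ g - 1 ∈ traceRadical S := by
      intro g
      rw [← Ideal.Quotient.eq]
      rfl
    obtain ⟨k, hk⟩ := isNilpotent_traceRadical S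
    have hnil : Group.IsNilpotent Γ₀ :=
      isNilpotent_of_sub_one_mem (φ.comp Γ₀.subtype) (hφ.comp Subtype.val_injective)
        (traceRadical S) hk fun g => (hmem g).1 g.2
    obtain ⟨m, hm, hxm⟩ := exists_pow_sub_one_mem_traceRadical R hfin φ (fun _ => rfl) x
    obtain ⟨n, hn, hyn⟩ := exists_pow_sub_one_mem_traceRadical R hfin φ (fun _ => rfl) y
    refine ⟨m, n, hm, hn, ?_⟩
    exact (IsFreeGroup.commute_of_isNilpotent (⟨_, (hmem _).2 hxm⟩ : Γ₀)
      ⟨_, (hmem _).2 hyn⟩).map Γ₀.subtype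
  · obtain ⟨β, hβ, hβN⟩ := hβ x
    have hdvd : (R x).charpoly ∣ (Polynomial.X ^ N - 1) ^ p ^ Module.finrank K V := by
      refine dvd_trans ?_ (pow_dvd_pow _ (Nat.lt_pow_self hp.out.one_lt).le)
      refine hβ.dvd.trans ((Finset.prod_dvd_prod_of_dvd _ _ fun i _ =>
        Polynomial.dvd_iff_isRoot.2
          (?_ : (Polynomial.X ^ N - 1 : Polynomial K).IsRoot (β i))).trans ?_)
      · simp [hβN]
      · simp
    rw [sub_pow_char_pow, one_pow, ← pow_mul] at hdvd
    obtain ⟨q, hq⟩ := hdvd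
    have h := congrArg (Polynomial.aeval (R x)) hq
    rw [map_mul, LinearMap.aeval_self_charpoly, zero_mul, map_sub, map_pow, Polynomial.aeval_X,
      map_one, sub_eq_zero, ← map_pow, ← map_one R] at h
    refine ⟨N * p ^ Module.finrank K V, 1, Nat.mul_pos hN (pow_pos hp.out.pos _), one_pos, ?_⟩
    rw [hR h]
    exact Commute.one_left _

/-- Every linear representation of the poison group has a kernel meeting the second factor. -/
theorem exists_poisonOf_eq_one {K V : Type*} [Field K] [IsAlgClosed K] [AddCommGroup V]
    [Module K V] [FiniteDimensional K V] (ρ : PoisonGroup →* (Module.End K V)ˣ) :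
    ∃ g, g ≠ 1 ∧ ρ (poisonOf (1, g)) = 1 := by
  let L : FreeGroup (Fin 2) →* Module.End K V :=
    (Units.coeHom _).comp (ρ.comp (poisonOf.comp (MonoidHom.inl _ _)))
  let R : FreeGroup (Fin 2) →* Module.End K V :=
    (Units.coeHom _).comp (ρ.comp (poisonOf.comp (MonoidHom.inr _ _)))
  by_contra! hinj
  have hR : Function.Injective R := by
    rw [injective_iff_map_eq_one]
    intro g hg
    by_contra hne
    exact hinj g hne (Units.ext hg)
  obtain ⟨N, hN, hβ⟩ := exists_charpoly_eq_prod_of_mem_commutator L R (ρ poisonT)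
    (fun g h => ((commute_poisonOf g h).map ρ).map (Units.coeHom _))
    (fun g => by
      have hgg : poisonOf (g, g) = poisonOf (g, 1) * poisonOf (1, g) := by
        rw [← map_mul, Prod.mk_mul_mk, mul_one, one_mul]
      have := congrArg (fun u => (ρ u).val) (poisonT_mul_of_diag g)
      rw [hgg] at this
      simp only [map_mul, Units.val_mul] at this
      exact this)
  obtain ⟨x, hx, y, hy, hxy⟩ := exists_forall_not_commute_pow
  obtain ⟨m, n, hm, hn, h⟩ := exists_commute_pow_of_charpoly
    (R.comp (commutator (FreeGroup (Fin 2))).subtype) (hR.comp Subtype.val_injective) hN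
    (fun g => hβ g g.2) ⟨x, hx⟩ ⟨y, hy⟩
  exact hxy m n hm hn (h.map (commutator (FreeGroup (Fin 2))).subtype)

theorem not_isLinear_H5 : ¬ IsLinear H5 := by
  rintro ⟨K, inst, n, f, hf⟩
  let ι : Matrix (Fin n) (Fin n) K →+* Matrix (Fin n) (Fin n) (AlgebraicClosure K) :=
    (algebraMap K (AlgebraicClosure K)).mapMatrix
  have hι : Function.Injective ι :=
    Matrix.map_injective (algebraMap K (AlgebraicClosure K)).injective
  let ψ : H5 →* Matrix (Fin n) (Fin n) (AlgebraicClosure K) :=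
    ι.toMonoidHom.comp ((Units.coeHom _).comp f)
  have hψ : Function.Injective ψ := hι.comp (Units.val_injective.comp hf)
  let e : Matrix (Fin 2) (Fin 2) (Matrix (Fin n) (Fin n) (AlgebraicClosure K)) ≃+*
      Module.End (AlgebraicClosure K) (Fin 2 × Fin n → AlgebraicClosure K) :=
    (Matrix.compRingEquiv (Fin 2) (Fin n) (AlgebraicClosure K)).trans
      Matrix.toLinAlgEquiv'.toRingEquiv
  obtain ⟨g, hg, h⟩ := exists_poisonOf_eq_one ((Units.map e.toMonoidHom).comp (induced ψ))
  have h1 : (induced ψ (poisonOf (1, g))).val = 1 := by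
    refine e.injective ((congrArg Units.val h).trans ?_)
    rw [map_one, Units.val_one]
  rw [induced_of_val] at h1
  have h2 : ψ (h5Vertex (1, g)) = 1 := congrFun (congrFun h1 0) 0
  have h3 := h5Vertex_injective ((hψ (h2.trans (map_one ψ).symm)).trans (map_one h5Vertex).symm)
  exact hg (congrArg Prod.snd h3)

end NonLinear

/-- `H` is isomorphic to a normal subgroup of index 2 in the poison group
`H(F₂)`, and `H` is not linear. -/
theorem H5_index_two_in_poison_and_not_linear :
    (∃ N : Subgroup PoisonGroup, N.Normal ∧ N.index = 2 ∧ Nonempty (H5 ≃* N)) ∧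
    ¬ IsLinear H5 :=
  ⟨exists_normal_index_two_mulEquiv, not_isLinear_H5⟩
end
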